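/- arXiv:1910.08920 — 2 statements merged into one kernel-verified Lean document; each statement's English description precedes it below -/
import Mathlib

section
/- There exist constants c1, c2, c3 > 0 and a family of DAGs {G_N} such that G_N has at most c3·N nodes, constant indegree, and is (c1·N·log log N/log N, c2·N/(log N)^{1 + log log N})-depth-robust. -/
/-! ## Basic digraph notions -/

/-- A directed path in a digraph `Adj`: a nonempty list of vertices, each
consecutive pair joined by a directed edge.  Its length (number of edges)
is `p.length - 1`, so a path "of length d" is a list with `p.length = d + 1`. -/
def PathIn {V : Type*} (Adj : V → V → Prop) (p : List V) : Prop :=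
  p ≠ [] ∧ p.Chain' Adj

/-- A digraph is acyclic (is a DAG) if it has no directed cycle. -/
def Acyclic {V : Type*} (Adj : V → V → Prop) : Prop :=
  ∀ v, ¬ Relation.TransGen Adj v v

/-- In-degree of a vertex. -/
noncomputable def indeg {V : Type*} (Adj : V → V → Prop) (v : V) : ℕ :=
  Nat.card {u // Adj u v}

/-- Out-degree of a vertex. -/
noncomputable def outdeg {V : Type*} (Adj : V → V → Prop) (v : V) : ℕ :=
  Nat.card {w // Adj v w}

/-- `δ(v) = max(indeg(v), outdeg(v))`. -/
noncomputable def delta {V : Type*} (Adj : V → V → Prop) (v : V) : ℕ :=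
  max (indeg Adj v) (outdeg Adj v)

/-- The number of edges of a digraph. -/
noncomputable def numEdges {V : Type*} (Adj : V → V → Prop) : ℕ :=
  Nat.card {e : V × V // Adj e.1 e.2}

/-- `(e,d)`-depth-robustness: for every set `S` of at most `e` vertices,
the graph minus `S` contains a directed path of length `d` (i.e. `d` edges). -/
def DepthRobust {V : Type*} (Adj : V → V → Prop) (e d : ℕ) : Prop :=
  ∀ S : Finset V, S.card ≤ e →
    ∃ p : List V, PathIn Adj p ∧ (∀ v ∈ p, v ∉ S) ∧ p.length = d + 1

/-- `(e,d)`-edge-depth-robustness: for every set `F` of at most `e` edges,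
the graph minus `F` contains a directed path of length `d`. -/
def EdgeDepthRobust {V : Type*} (Adj : V → V → Prop) (e d : ℕ) : Prop :=
  ∀ F : Finset (V × V), (∀ f ∈ F, Adj f.1 f.2) → F.card ≤ e →
    ∃ p : List V, PathIn (fun u w => Adj u w ∧ (u, w) ∉ F) p ∧ p.length = d + 1

/-- `u` is joined to `v` by a directed path all of whose vertices avoid `S`. -/
def ConnAvoiding {V : Type*} (Adj : V → V → Prop) (S : Finset V) (u v : V) : Prop :=
  ∃ p : List V, PathIn Adj p ∧ (∀ x ∈ p, x ∉ S) ∧ p.head? = some u ∧ p.getLast? = some v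

/-- `u` is joined to `v` by a directed path of length at least `d` avoiding `S`. -/
def ConnAvoidingLen {V : Type*} (Adj : V → V → Prop) (S : Finset V) (d : ℕ) (u v : V) : Prop :=
  ∃ p : List V, PathIn Adj p ∧ (∀ x ∈ p, x ∉ S) ∧ p.head? = some u ∧
    p.getLast? = some v ∧ d + 1 ≤ p.length

/-! ## Digraphs with designated inputs and outputs -/

/-- A finite digraph with `n` designated (distinct) inputs and `n` designated
(distinct) outputs. -/
structure IOGraph (n : ℕ) where
  V : Type
  [fin : Fintype V]
  [dec : DecidableEq V]
  Adj : V → V → Prop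
  inp : Fin n ↪ V
  out : Fin n ↪ V

attribute [instance] IOGraph.fin IOGraph.dec

/-- `(k1,k2)`-ST-robustness: after deleting any set `D` of at most `k1` vertices
there remain at least `k2` inputs and `k2` outputs such that every one of these
inputs is connected to every one of these outputs in `G - D`. -/
def STRobust {n : ℕ} (G : IOGraph n) (k1 k2 : ℕ) : Prop :=
  ∀ D : Finset G.V, D.card ≤ k1 →
    ∃ A B : Finset (Fin n), k2 ≤ A.card ∧ k2 ≤ B.card ∧
      ∀ a ∈ A, ∀ b ∈ B, ConnAvoiding G.Adj D (G.inp a) (G.out b)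

/-- `(k1,k2,d)`-ST-robustness: as `STRobust`, with all the connecting paths of
length at least `d`. -/
def STRobustD {n : ℕ} (G : IOGraph n) (k1 k2 d : ℕ) : Prop :=
  ∀ D : Finset G.V, D.card ≤ k1 →
    ∃ A B : Finset (Fin n), k2 ≤ A.card ∧ k2 ≤ B.card ∧
      ∀ a ∈ A, ∀ b ∈ B, ConnAvoidingLen G.Adj D d (G.inp a) (G.out b)

/-- Maximally ST-robust: `(k, n-k)`-ST-robust for all `0 ≤ k ≤ n`. -/
def MaxSTRobust {n : ℕ} (G : IOGraph n) : Prop := ∀ k ≤ n, STRobust G k (n - k)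

/-- Maximally ST-robust with depth `d`: `(k, n-k, d)`-ST-robust for all `0 ≤ k ≤ n`. -/
def MaxSTRobustD {n : ℕ} (G : IOGraph n) (d : ℕ) : Prop := ∀ k ≤ n, STRobustD G k (n - k) d

/-- An `n`-superconcentrator: for every `1 ≤ r ≤ n` and every `r` inputs and `r`
outputs there are `r` vertex-disjoint directed paths connecting the chosen inputs
to the chosen outputs. -/
def Superconcentrator {n : ℕ} (G : IOGraph n) : Prop :=
  ∀ r, 1 ≤ r → r ≤ n → ∀ X Y : Finset (Fin n), X.card = r → Y.card = r →
    ∃ P : Fin r → List G.V,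
      (∀ i, PathIn G.Adj (P i) ∧ (∃ x ∈ X, (P i).head? = some (G.inp x)) ∧
        ∃ y ∈ Y, (P i).getLast? = some (G.out y)) ∧
      ∀ i j, i ≠ j → ∀ v ∈ P i, v ∉ P j

/-- An `n`-connector: an `n`-superconcentrator such that moreover, for every
`1 ≤ r ≤ n`, every sequence of `r` distinct inputs and every sequence of `r`
distinct outputs, there are `r` vertex-disjoint directed paths where the `i`-th
path goes from the `i`-th chosen input to the `i`-th chosen output. -/
def Connector {n : ℕ} (G : IOGraph n) : Prop :=
  Superconcentrator G ∧
  ∀ r, 1 ≤ r → r ≤ n → ∀ x y : Fin r ↪ Fin n,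
    ∃ P : Fin r → List G.V,
      (∀ i, PathIn G.Adj (P i) ∧ (P i).head? = some (G.inp (x i)) ∧
        (P i).getLast? = some (G.out (y i))) ∧
      ∀ i j, i ≠ j → ∀ v ∈ P i, v ∉ P j

/-- A bundled finite digraph. -/
structure Dig where
  V : Type
  [fin : Fintype V]
  [dec : DecidableEq V]
  Adj : V → V → Prop

attribute [instance] Dig.fin Dig.dec

/-- `(s,t,ε)`-hardness of a graph together with a challenge set `VC`: for every
set `S` of at most `s` vertices, at least a `(1-ε)` fraction of the nodes of `VC`
have depth at least `t` in `G - S` (i.e. are the endpoint of a directed path of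
length `≥ t` in `G - S`). -/
def Hard {T : Type*} (Adj : T → T → Prop) (VC : Finset T) (s t : ℕ) (ε : ℝ) : Prop :=
  ∀ S : Finset T, S.card ≤ s →
    (1 - ε) * (VC.card : ℝ) ≤
      (Set.ncard {v | v ∈ VC ∧ ∃ p : List T, PathIn Adj p ∧ (∀ x ∈ p, x ∉ S) ∧
        p.getLast? = some v ∧ t + 1 ≤ p.length} : ℝ)


lemma perm_count {α : Type*} [Fintype α] [DecidableEq α] (Y : Finset α)
    (hY : 16 * Y.card ≤ 9 * Fintype.card α) (Z : Finset α) :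
    16 ^ Z.card * (Finset.univ.filter (fun π : Equiv.Perm α => ∀ x ∈ Z, π x ∈ Y)).card
      ≤ 9 ^ Z.card * (Fintype.card α).factorial := by
  classical
  induction Z using Finset.induction_on with
  | empty => simp [Fintype.card_perm]
  | insert a Z ha ih =>
    set P := Finset.univ.filter (fun π : Equiv.Perm α => ∀ x ∈ Z, π x ∈ Y) with hP
    set Q : α → Finset (Equiv.Perm α) := fun b => P.filter (fun π => π b ∈ Y) with hQ
    have e1 : Finset.univ.filter (fun π : Equiv.Perm α => ∀ x ∈ insert a Z, π x ∈ Y) = Q a := by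
      ext π; simp [hQ, hP, Finset.forall_mem_insert, and_comm]
    have e2 : ∀ b ∈ Zᶜ, (Q b).card = (Q a).card := by
      intro b hb
      have hb' : b ∉ Z := by simpa using hb
      apply Finset.card_bij (fun π _ => π * Equiv.swap a b)
      · intro π hπ
        simp only [hQ, hP, Finset.mem_filter, Finset.mem_univ, true_and] at hπ ⊢
        refine ⟨fun x hx => ?_, ?_⟩
        · have h1 : x ≠ a := fun h => ha (h ▸ hx)
          have h2 : x ≠ b := fun h => hb' (h ▸ hx)
          simpa [Equiv.swap_apply_of_ne_of_ne h1 h2] using hπ.1 x hx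
        · simpa using hπ.2
      · intro π _ π' _ h
        exact mul_right_cancel h
      · intro π hπ
        refine ⟨π * Equiv.swap a b, ?_, by simp [mul_assoc]⟩
        simp only [hQ, hP, Finset.mem_filter, Finset.mem_univ, true_and] at hπ ⊢
        refine ⟨fun x hx => ?_, ?_⟩
        · have h1 : x ≠ a := fun h => ha (h ▸ hx)
          have h2 : x ≠ b := fun h => hb' (h ▸ hx)
          simpa [Equiv.swap_apply_of_ne_of_ne h1 h2] using hπ.1 x hx
        · simpa using hπ.2
    have e3 : ∑ b ∈ Zᶜ, (Q b).card = (Zᶜ).card * (Q a).card := by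
      rw [Finset.sum_congr rfl e2]; simp
    have e4 : ∑ b ∈ Zᶜ, (Q b).card = ∑ π ∈ P, ((Zᶜ).filter (fun b => π b ∈ Y)).card := by
      simp only [hQ, Finset.card_filter]
      rw [Finset.sum_comm]
    have e5 : ∀ π ∈ P, ((Zᶜ).filter (fun b => π b ∈ Y)).card + Z.card = Y.card := by
      intro π hπ
      simp only [hP, Finset.mem_filter, Finset.mem_univ, true_and] at hπ
      have : Y = (((Zᶜ).filter (fun b => π b ∈ Y)) ∪ Z).image π := by
        ext y
        simp only [Finset.mem_image, Finset.mem_union, Finset.mem_filter, Finset.mem_compl]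
        constructor
        · intro hy
          refine ⟨π.symm y, ?_, by simp⟩
          by_cases h : π.symm y ∈ Z
          · exact Or.inr h
          · left; exact ⟨h, by simpa using hy⟩
        · rintro ⟨x, h | h, rfl⟩
          · exact h.2
          · exact hπ x h
      have hd : Disjoint ((Zᶜ).filter (fun b => π b ∈ Y)) Z := by
        rw [Finset.disjoint_left]; intro x hx; simpa using (Finset.mem_filter.1 hx).1
      calc _ = (((Zᶜ).filter (fun b => π b ∈ Y)) ∪ Z).card := (Finset.card_union_of_disjoint hd).symm
        _ = ((((Zᶜ).filter (fun b => π b ∈ Y)) ∪ Z).image π).card :=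
            (Finset.card_image_of_injective _ π.injective).symm
        _ = Y.card := by rw [← this]
    have hc : (Zᶜ).card + Z.card = Fintype.card α := by rw [Finset.card_compl]; have := Finset.card_le_univ Z; omega
    have hpos : 0 < (Zᶜ).card := Finset.card_pos.2 ⟨a, by simpa using ha⟩
    have e6 : 16 * (∑ π ∈ P, ((Zᶜ).filter (fun b => π b ∈ Y)).card) ≤ 9 * (Zᶜ).card * P.card := by
      rw [Finset.mul_sum]
      calc _ ≤ ∑ π ∈ P, 9 * (Zᶜ).card := Finset.sum_le_sum (fun π hπ => by have := e5 π hπ; omega)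
        _ = _ := by simp [mul_comm]
    have e7 : 16 * (Q a).card ≤ 9 * P.card := by
      rw [← e4, e3] at e6
      apply Nat.le_of_mul_le_mul_left _ hpos
      nlinarith
    rw [e1, Finset.card_insert_of_notMem ha]
    calc 16 ^ (Z.card + 1) * (Q a).card = 16 ^ Z.card * (16 * (Q a).card) := by ring
      _ ≤ 16 ^ Z.card * (9 * P.card) := by gcongr
      _ = 9 * (16 ^ Z.card * P.card) := by ring
      _ ≤ 9 * (9 ^ Z.card * (Fintype.card α).factorial) := by gcongr
      _ = _ := by ring

lemma lane_sum {α : Type*} [Fintype α] [DecidableEq α] (S Y : Finset α)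
    (hY : 16 * Y.card ≤ 9 * Fintype.card α) :
    16 ^ S.card * (∑ π : Equiv.Perm α, 2 ^ (S.filter (fun x => π x ∈ Y)).card)
      ≤ 25 ^ S.card * (Fintype.card α).factorial := by
  classical
  have h1 : ∀ π : Equiv.Perm α, 2 ^ (S.filter (fun x => π x ∈ Y)).card
      = ∑ Z ∈ S.powerset, if ∀ x ∈ Z, π x ∈ Y then 1 else 0 := by
    intro π
    rw [← Finset.card_powerset, ← Finset.card_filter]
    congr 1
    ext Z
    simp only [Finset.mem_powerset, Finset.mem_filter, Finset.subset_iff]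
    constructor
    · intro h; exact ⟨fun x hx => (h hx).1, fun x hx => (h hx).2⟩
    · intro h x hx; exact ⟨h.1 hx, h.2 x hx⟩
  simp_rw [h1]
  rw [Finset.sum_comm, Finset.mul_sum]
  calc _ ≤ ∑ Z ∈ S.powerset, 9 ^ Z.card * 16 ^ (S.card - Z.card) * (Fintype.card α).factorial := by
        apply Finset.sum_le_sum
        intro Z hZ
        have hle := Finset.card_le_card (Finset.mem_powerset.1 hZ)
        rw [← Finset.card_filter]
        have := perm_count Y hY Z
        calc _ = 16 ^ (S.card - Z.card) * (16 ^ Z.card * (Finset.univ.filter (fun π : Equiv.Perm α => ∀ x ∈ Z, π x ∈ Y)).card) := by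
              rw [← mul_assoc, ← pow_add, Nat.sub_add_cancel hle]
          _ ≤ 16 ^ (S.card - Z.card) * (9 ^ Z.card * (Fintype.card α).factorial) := by gcongr
          _ = _ := by ring
    _ = _ := by
        rw [← Finset.sum_mul, Finset.sum_pow_mul_eq_add_pow]

/-- number of edges from `S` into `Y` -/
def hits {α : Type*} [DecidableEq α] {Δ : ℕ} (π : Fin Δ → Equiv.Perm α) (S Y : Finset α) : ℕ :=
  ∑ s, (S.filter (fun x => π s x ∈ Y)).card

lemma bad_count {α : Type*} [Fintype α] [DecidableEq α] (D : ℕ) (S Y : Finset α)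
    (hY : 16 * Y.card ≤ 9 * Fintype.card α) (hS : 2 * Fintype.card α ≤ D * S.card) :
    2 ^ (8 * Fintype.card α) * (Finset.univ.filter (fun π : Fin (16 * D) → Equiv.Perm α =>
      15 * D * S.card ≤ hits π S Y)).card ≤ Fintype.card (Fin (16 * D) → Equiv.Perm α) := by
  classical
  set B := Finset.univ.filter (fun π : Fin (16 * D) → Equiv.Perm α => 15 * D * S.card ≤ hits π S Y) with hB
  have h1 : ∑ π : Fin (16 * D) → Equiv.Perm α, 2 ^ hits π S Y
      = (∑ π : Equiv.Perm α, 2 ^ (S.filter (fun x => π x ∈ Y)).card) ^ (16 * D) := by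
    have := Finset.prod_univ_sum (fun _ : Fin (16 * D) => (Finset.univ : Finset (Equiv.Perm α)))
      (fun _ π => 2 ^ (S.filter (fun x => π x ∈ Y)).card)
    rw [Fintype.piFinset_univ] at this
    simp only [Finset.prod_const, Finset.card_univ, Fintype.card_fin] at this
    rw [this]
    apply Finset.sum_congr rfl
    intro π _
    rw [hits, Finset.prod_pow_eq_pow_sum]
  have h2 : 2 ^ (15 * D * S.card) * B.card ≤ ∑ π : Fin (16 * D) → Equiv.Perm α, 2 ^ hits π S Y := by
    calc _ = ∑ π ∈ B, 2 ^ (15 * D * S.card) := by simp [mul_comm]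
      _ ≤ ∑ π ∈ B, 2 ^ hits π S Y := Finset.sum_le_sum (fun π hπ =>
          Nat.pow_le_pow_right (by norm_num) (by simpa [hB] using hπ))
      _ ≤ _ := Finset.sum_le_sum_of_subset (Finset.subset_univ _)
  have h3 := Nat.pow_le_pow_left (lane_sum S Y hY) (16 * D)
  rw [mul_pow, mul_pow, ← h1] at h3
  have hcard : Fintype.card (Fin (16 * D) → Equiv.Perm α) = (Fintype.card α).factorial ^ (16 * D) := by
    simp [Fintype.card_perm]
  rw [hcard]
  set F := (Fintype.card α).factorial ^ (16 * D)
  set x := D * S.card with hx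
  have h4 : (2 ^ 79) ^ x * B.card ≤ (25 ^ 16) ^ x * F := by
    calc (2 ^ 79) ^ x * B.card = (16 ^ S.card) ^ (16 * D) * (2 ^ (15 * D * S.card) * B.card) := by
          have : (16 ^ S.card) ^ (16 * D) * 2 ^ (15 * D * S.card) = (2 ^ 79) ^ x := by
            rw [show (16:ℕ) = 2 ^ 4 by norm_num, ← pow_mul, ← pow_mul, ← pow_add, ← pow_mul, hx]
            congr 1; ring
          rw [← mul_assoc, this]
      _ ≤ (16 ^ S.card) ^ (16 * D) * ∑ π : Fin (16 * D) → Equiv.Perm α, 2 ^ hits π S Y := by gcongr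
      _ ≤ (25 ^ S.card) ^ (16 * D) * F := h3
      _ = _ := by
          congr 1
          rw [← pow_mul, ← pow_mul, hx]; congr 1; ring
  have h5 : (25 ^ 16) ^ x ≤ (2 ^ 75) ^ x := Nat.pow_le_pow_left (by norm_num) x
  have h6 : (2 ^ 75) ^ x * ((2 ^ 4) ^ x * B.card) ≤ (2 ^ 75) ^ x * F := by
    calc _ = (2 ^ 79) ^ x * B.card := by rw [← mul_assoc, ← mul_pow]; norm_num
      _ ≤ (25 ^ 16) ^ x * F := h4
      _ ≤ _ := by gcongr
  have h7 := Nat.le_of_mul_le_mul_left h6 (by positivity)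
  refine le_trans ?_ h7
  refine Nat.mul_le_mul_right _ ?_
  rw [← pow_mul]
  exact Nat.pow_le_pow_right (by norm_num) (by omega)

lemma exists_mixing (α : Type*) [Fintype α] [DecidableEq α] [Nonempty α] (D : ℕ) :
    ∃ π : Fin (16 * D) → Equiv.Perm α, ∀ S Y : Finset α, 16 * Y.card ≤ 9 * Fintype.card α →
      2 * Fintype.card α ≤ D * S.card →
      hits π S Y < 15 * D * S.card ∧ hits (fun s => (π s).symm) S Y < 15 * D * S.card := by
  classical
  by_contra hcon
  push Not at hcon
  set n := Fintype.card α with hn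
  set Tot := Fintype.card (Fin (16 * D) → Equiv.Perm α) with hTot
  let Pr := (Finset.univ : Finset (Finset α × Finset α)).filter
    (fun p => 16 * p.2.card ≤ 9 * n ∧ 2 * n ≤ D * p.1.card)
  let B1 : Finset α × Finset α → Finset (Fin (16 * D) → Equiv.Perm α) := fun p =>
    Finset.univ.filter (fun π => 15 * D * p.1.card ≤ hits π p.1 p.2)
  let B2 : Finset α × Finset α → Finset (Fin (16 * D) → Equiv.Perm α) := fun p =>
    Finset.univ.filter (fun π => 15 * D * p.1.card ≤ hits (fun s => (π s).symm) p.1 p.2)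
  have hB2 : ∀ p, (B2 p).card = (B1 p).card := by
    intro p
    apply Finset.card_bij (fun π _ => fun s => (π s).symm)
    · intro π hπ; simpa [B1, B2] using hπ
    · intro π _ π' _ h
      funext s
      have := congrFun h s
      exact Equiv.symm_bijective.injective this
    · intro π hπ
      exact ⟨fun s => (π s).symm, by simpa [B1, B2] using hπ, by simp⟩
  have hcov : (Finset.univ : Finset (Fin (16 * D) → Equiv.Perm α)) ⊆ Pr.biUnion (fun p => B1 p ∪ B2 p) := by
    intro π _
    obtain ⟨S, Y, h1, h2, h3⟩ := hcon π
    simp only [Finset.mem_biUnion, Finset.mem_union]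
    refine ⟨(S, Y), by simp [Pr]; exact ⟨h1, h2⟩, ?_⟩
    by_cases h : hits π S Y < 15 * D * S.card
    · right; simpa [B2] using h3 h
    · left; simpa [B1] using h
  have h1 : Tot ≤ ∑ p ∈ Pr, 2 * (B1 p).card := by
    calc Tot = (Finset.univ : Finset (Fin (16 * D) → Equiv.Perm α)).card := by simp [hTot]
      _ ≤ _ := Finset.card_le_card hcov
      _ ≤ ∑ p ∈ Pr, (B1 p ∪ B2 p).card := Finset.card_biUnion_le
      _ ≤ _ := Finset.sum_le_sum (fun p _ => by
          have := Finset.card_union_le (B1 p) (B2 p); rw [hB2] at this; omega)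
  have h2 : 2 ^ (8 * n) * Tot ≤ ∑ p ∈ Pr, 2 * Tot := by
    calc _ ≤ 2 ^ (8 * n) * ∑ p ∈ Pr, 2 * (B1 p).card := by gcongr
      _ = ∑ p ∈ Pr, 2 * (2 ^ (8 * n) * (B1 p).card) := by
          rw [Finset.mul_sum]; apply Finset.sum_congr rfl; intros; ring
      _ ≤ _ := Finset.sum_le_sum (fun p hp => by
          simp only [Pr, Finset.mem_filter, Finset.mem_univ, true_and] at hp
          have := bad_count D p.1 p.2 hp.1 hp.2
          gcongr)
  have h3 : ∑ p ∈ Pr, 2 * Tot ≤ 2 ^ (2 * n) * (2 * Tot) := by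
    rw [Finset.sum_const, smul_eq_mul]
    gcongr
    calc Pr.card ≤ Fintype.card (Finset α × Finset α) := Finset.card_le_univ _
      _ = 2 ^ (2 * n) := by simp [Fintype.card_prod, Fintype.card_finset, ← hn, two_mul, pow_add]
  have hTpos : 0 < Tot := Fintype.card_pos
  have hnpos : 0 < n := Fintype.card_pos
  have h4 : 2 ^ (8 * n) ≤ 2 ^ (2 * n + 1) := by
    apply Nat.le_of_mul_le_mul_right _ hTpos
    calc _ ≤ _ := h2.trans h3
      _ = _ := by ring
  have := (Nat.pow_le_pow_iff_right (by norm_num : 1 < 2)).1 h4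
  omega


/-- dyadic block -/
noncomputable def Blk (j : ℕ) (k : ℤ) : Finset ℤ := Finset.Ico (k * 2 ^ j) ((k + 1) * 2 ^ j)

lemma mem_Blk {j : ℕ} {k x : ℤ} : x ∈ Blk j k ↔ x / 2 ^ j = k := by
  have hp : (0 : ℤ) < 2 ^ j := by positivity
  rw [Blk, Finset.mem_Ico]
  constructor
  · rintro ⟨h1, h2⟩
    apply le_antisymm
    · exact Int.lt_add_one_iff.1 ((Int.ediv_lt_iff_lt_mul hp).2 h2)
    · exact (Int.le_ediv_iff_mul_le hp).2 h1
  · rintro rfl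
    exact ⟨(Int.le_ediv_iff_mul_le hp).1 le_rfl, (Int.ediv_lt_iff_lt_mul hp).1 (Int.lt_succ _)⟩

lemma card_Blk (j : ℕ) (k : ℤ) : (Blk j k).card = 2 ^ j := by
  rw [Blk, Int.card_Ico]
  have : (k + 1) * 2 ^ j - k * 2 ^ j = ((2 ^ j : ℕ) : ℤ) := by push_cast; ring
  rw [this, Int.toNat_natCast]

/-- level-`i` mixing with direction `σ` -/
def Mix (D i : ℕ) (σ : ℤ) (ν : Fin (16 * D) → Equiv.Perm ℤ) : Prop :=
  (∀ s x, ν s x / 2 ^ i = x / 2 ^ i + σ) ∧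
  ∀ (k : ℤ) (S Y : Finset ℤ), S ⊆ Blk i k → Y ⊆ Blk i (k + σ) → 16 * Y.card ≤ 9 * 2 ^ i →
    2 * 2 ^ i ≤ D * S.card →
    ∑ s, (S.filter (fun x => ν s x ∈ Y)).card < 15 * D * S.card

lemma mix_aux (D i : ℕ) (σ : ℤ) (π : Fin (16 * D) → Equiv.Perm (Fin (2 ^ i)))
    (ν : Fin (16 * D) → Equiv.Perm ℤ)
    (h1 : ∀ s x, ν s x / 2 ^ i = x / 2 ^ i + σ)
    (h2 : ∀ s x, (Int.divModEquiv (2 ^ i) (ν s x)).2 = π s (Int.divModEquiv (2 ^ i) x).2)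
    (hπ : ∀ S Y : Finset (Fin (2 ^ i)), 16 * Y.card ≤ 9 * Fintype.card (Fin (2 ^ i)) →
      2 * Fintype.card (Fin (2 ^ i)) ≤ D * S.card → hits π S Y < 15 * D * S.card) :
    Mix D i σ ν := by
  refine ⟨h1, fun k S Y hS hY hYc hSc => ?_⟩
  set E := Int.divModEquiv (2 ^ i)
  have hE1 : ∀ x, (E x).1 = x / 2 ^ i := by
    intro x; simp [E, Int.divModEquiv]
  have inj : ∀ k' : ℤ, ∀ Z : Finset ℤ, Z ⊆ Blk i k' → Set.InjOn (fun x => (E x).2) (Z : Set ℤ) := by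
    intro k' Z hZ x hx y hy hxy
    apply E.injective
    refine Prod.ext ?_ hxy
    rw [hE1, hE1, mem_Blk.1 (hZ hx), mem_Blk.1 (hZ hy)]
  have c1 : (S.image (fun x => (E x).2)).card = S.card := Finset.card_image_of_injOn (inj k S hS)
  have c2 : (Y.image (fun x => (E x).2)).card = Y.card := Finset.card_image_of_injOn (inj _ Y hY)
  have := hπ (S.image (fun x => (E x).2)) (Y.image (fun x => (E x).2))
    (by rw [c2]; simpa using hYc) (by rw [c1]; simpa using hSc)
  rw [c1] at this
  refine lt_of_le_of_lt ?_ this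
  unfold hits
  apply Finset.sum_le_sum
  intro s _
  apply Finset.card_le_card_of_injOn (fun x => (E x).2)
  · intro x hx
    simp only [Finset.coe_filter, Set.mem_ofPred_eq] at hx ⊢
    exact ⟨Finset.mem_image_of_mem _ hx.1, Finset.mem_image.2 ⟨ν s x, hx.2, h2 s x⟩⟩
  · exact (inj k S hS).mono (by intro x hx; exact (Finset.mem_filter.1 hx).1)

lemma exists_nxt (D i : ℕ) : ∃ ν : Fin (16 * D) → Equiv.Perm ℤ,
    Mix D i 1 ν ∧ Mix D i (-1) (fun s => (ν s).symm) := by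
  obtain ⟨π, hπ⟩ := exists_mixing (Fin (2 ^ i)) D
  set E := Int.divModEquiv (2 ^ i) with hE
  have hE1 : ∀ x, (E x).1 = x / 2 ^ i := by
    intro x; simp [E, Int.divModEquiv]
  let ν : Fin (16 * D) → Equiv.Perm ℤ := fun s =>
    (E.trans ((Equiv.addRight (1 : ℤ)).prodCongr (π s))).trans E.symm
  have hν : ∀ s x, E (ν s x) = ((E x).1 + 1, π s (E x).2) := by
    intro s x; simp [ν]; rfl
  have hν' : ∀ s x, E ((ν s).symm x) = ((E x).1 - 1, (π s).symm (E x).2) := by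
    intro s x
    have := hν s ((ν s).symm x)
    rw [Equiv.apply_symm_apply] at this
    rw [this]; simp
  refine ⟨ν, mix_aux D i 1 π ν ?_ ?_ (fun S Y h h' => (hπ S Y h h').1),
    mix_aux D i (-1) (fun s => (π s).symm) _ ?_ ?_ (fun S Y h h' => (hπ S Y h h').2)⟩
  · intro s x; rw [← hE1, ← hE1, hν]
  · intro s x; rw [← hE, hν]
  · intro s x; rw [← hE1, ← hE1, hν']; rfl
  · intro s x; rw [← hE, hν']


lemma div_pow_pow (x : ℤ) (j r : ℕ) : x / 2 ^ j / 2 ^ r = x / 2 ^ (j + r) := by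
  rw [pow_add, Int.ediv_ediv_of_nonneg (by positivity)]

lemma div_close {a b : ℤ} {w : ℤ} (hw : 0 ≤ w) (r : ℕ) (h : |a - b| ≤ w) :
    |a / 2 ^ r - b / 2 ^ r| ≤ w := by
  have hp : (0 : ℤ) < 2 ^ r := by positivity
  have h1 : (1 : ℤ) ≤ 2 ^ r := hp
  have key : ∀ a b : ℤ, a ≤ b + w → a / 2 ^ r ≤ b / 2 ^ r + w := by
    intro a b hab
    calc a / 2 ^ r ≤ (b + w * 2 ^ r) / 2 ^ r := Int.ediv_le_ediv hp (by nlinarith)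
      _ = b / 2 ^ r + w := Int.add_mul_ediv_right _ _ hp.ne'
  rw [abs_le] at h ⊢
  have := key a b (by linarith)
  have := key b a (by linarith)
  constructor <;> linarith

open Classical in
lemma max_lemma (n lam E : ℕ) (c : ℤ → ℕ) (U : Finset ℤ) (hE : ∀ F : Finset ℤ, ∑ x ∈ F, c x ≤ E) :
    (U.filter (fun u => ∃ j ≤ n, ∃ k' : ℤ, |u / 2 ^ j - k'| ≤ 8 ∧
      lam * 2 ^ j ≤ ∑ x ∈ Blk j k', c x)).card * lam ≤ 17 * E := by
  set U' := U.filter (fun u => ∃ j ≤ n, ∃ k' : ℤ, |u / 2 ^ j - k'| ≤ 8 ∧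
      lam * 2 ^ j ≤ ∑ x ∈ Blk j k', c x) with hU'
  let bad : ℕ → ℤ → Prop := fun j k => lam * 2 ^ j ≤ ∑ x ∈ Blk j k, c x
  have hex : ∀ u, ∃ p : ℕ × ℤ, u ∈ U' → p.1 ≤ n ∧ |u / 2 ^ p.1 - p.2| ≤ 8 ∧ bad p.1 p.2 ∧
      ∀ r, 0 < r → p.1 + r ≤ n → ¬ bad (p.1 + r) (p.2 / 2 ^ r) := by
    intro u
    by_cases hu : u ∈ U'
    swap
    · exact ⟨(0, 0), fun h => absurd h hu⟩
    obtain ⟨_, j, hj, k', hk, hb⟩ := Finset.mem_filter.1 hu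
    let R := (Finset.range (n - j + 1)).filter (fun r => bad (j + r) (k' / 2 ^ r))
    have hR : R.Nonempty := ⟨0, by simp [R]; exact hb⟩
    have hm := R.max'_mem hR
    set r := R.max' hR with hr
    obtain ⟨hr1, hr2⟩ := Finset.mem_filter.1 hm
    have hr1 := Finset.mem_range.1 hr1
    refine ⟨(j + r, k' / 2 ^ r), fun _ => ⟨by simp only; omega, ?_, hr2, ?_⟩⟩
    · simp only
      rw [← div_pow_pow]
      exact div_close (by norm_num) r hk
    · intro r' hr' hle hbad
      simp only at hle hbad
      rw [div_pow_pow, add_assoc] at hbad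
      have : r + r' ∈ R := Finset.mem_filter.2 ⟨Finset.mem_range.2 (by omega), hbad⟩
      have := R.le_max' _ this
      omega
  choose φ hφ using hex
  have hdisj : ∀ p ∈ U'.image φ, ∀ p' ∈ U'.image φ, p ≠ p' → Disjoint (Blk p.1 p.2) (Blk p'.1 p'.2) := by
    have key : ∀ p ∈ U'.image φ, ∀ p' ∈ U'.image φ, ∀ x, x ∈ Blk p.1 p.2 → x ∈ Blk p'.1 p'.2 →
        p'.1 ≤ p.1 := by
      intro p hp p' hp' x hx hx'
      obtain ⟨u, hu, rfl⟩ := Finset.mem_image.1 hp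
      obtain ⟨u', hu', rfl⟩ := Finset.mem_image.1 hp'
      by_contra hlt
      push Not at hlt
      have h := (hφ u hu).2.2.2 ((φ u').1 - (φ u).1) (by omega) (by have := (hφ u' hu').1; omega)
      apply h
      have e : (φ u).1 + ((φ u').1 - (φ u).1) = (φ u').1 := by omega
      rw [mem_Blk] at hx hx'
      rw [← hx, div_pow_pow, e, hx']
      exact (hφ u' hu').2.2.1
    intro p hp p' hp' hne
    rw [Finset.disjoint_left]
    intro x hx hx'
    have h1 := key p hp p' hp' x hx hx'
    have h2 := key p' hp' p hp x hx' hx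
    apply hne
    have e := le_antisymm h2 h1
    refine Prod.ext e ?_
    rw [mem_Blk] at hx hx'
    rw [← hx, ← hx', e]
  have hfib : ∀ p ∈ U'.image φ, (U'.filter (fun u => φ u = p)).card ≤ 17 * 2 ^ p.1 := by
    intro p hp
    calc _ ≤ (Finset.Ico ((p.2 - 8) * 2 ^ p.1) ((p.2 + 9) * 2 ^ p.1)).card := by
          apply Finset.card_le_card
          intro u hu
          obtain ⟨hu1, rfl⟩ := Finset.mem_filter.1 hu
          have h := (hφ u hu1).2.1
          rw [abs_le] at h
          have hp : (0 : ℤ) < 2 ^ (φ u).1 := by positivity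
          rw [Finset.mem_Ico]
          constructor
          · exact (Int.le_ediv_iff_mul_le hp).1 (by linarith)
          · exact (Int.ediv_lt_iff_lt_mul hp).1 (by linarith)
      _ = 17 * 2 ^ p.1 := by
          rw [Int.card_Ico]
          have : (p.2 + 9) * 2 ^ p.1 - (p.2 - 8) * 2 ^ p.1 = ((17 * 2 ^ p.1 : ℕ) : ℤ) := by
            push_cast; ring
          rw [this, Int.toNat_natCast]
  calc U'.card * lam = ∑ p ∈ U'.image φ, (U'.filter (fun u => φ u = p)).card * lam := by
        rw [← Finset.sum_mul, ← Finset.card_eq_sum_card_image]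
    _ ≤ ∑ p ∈ U'.image φ, 17 * ∑ x ∈ Blk p.1 p.2, c x := by
        apply Finset.sum_le_sum
        intro p hp
        have h1 := hfib p hp
        obtain ⟨u, hu, rfl⟩ := Finset.mem_image.1 hp
        have h2 : lam * 2 ^ (φ u).1 ≤ ∑ x ∈ Blk (φ u).1 (φ u).2, c x := (hφ u hu).2.2.1
        nlinarith
    _ = 17 * ∑ x ∈ (U'.image φ).biUnion (fun p => Blk p.1 p.2), c x := by
        rw [← Finset.mul_sum, Finset.sum_biUnion]
        intro p hp p' hp' hne
        exact hdisj p hp p' hp' hne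
    _ ≤ 17 * E := by gcongr; exact hE _


open Classical in
/-- one-directional system -/
structure Sys (D n ω : ℕ) (σ : ℤ) (ν : ℕ → Fin (16 * D) → Equiv.Perm ℤ) (dead : ℤ → Prop)
    (R : ℤ → ℤ → Prop) (Ch P Q : ℕ → Fin (16 * D) → ℤ → Prop) : Prop where
  mix : ∀ i, Mix D i σ (ν i)
  tr : ∀ x y z, R x y → R y z → R x z
  step : ∀ i < n, ∀ s x, ¬ dead x → ¬ dead (ν i s x) →
    R x (ν i s x) ∨ Ch i s x ∨ P i s x ∨ Q i s (ν i s x)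
  hP : ∀ i < n, ∀ x, ¬ dead x → (Finset.univ.filter (fun s => P i s x)).card ≤ ω
  hQ : ∀ i < n, ∀ x, ¬ dead x → (Finset.univ.filter (fun s => Q i s x)).card ≤ ω

open Classical in
/-- charge of level `i` near `u` is small -/
def GoodT (D n : ℕ) (Ch : ℕ → Fin (16 * D) → ℤ → Prop) (u : ℤ) (T : Finset ℕ) : Prop :=
  ∀ i < n, i ∉ T → ∀ j ≤ n, ∀ k' : ℤ, |u / 2 ^ j - k'| ≤ 8 →
    4 * ∑ x ∈ Blk j k', (Finset.univ.filter (fun s => Ch i s x)).card < D * 2 ^ j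

open Classical in
def GoodD (n : ℕ) (dead : ℤ → Prop) (u : ℤ) : Prop :=
  ∀ j ≤ n, ∀ k' : ℤ, |u / 2 ^ j - k'| ≤ 8 → 64 * ((Blk j k').filter dead).card < 2 ^ j

open Classical in
def Half (dead : ℤ → Prop) (R : ℤ → ℤ → Prop) (u : ℤ) (i : ℕ) (k : ℤ) : Prop :=
  2 ^ i < 2 * ((Blk i k).filter (fun y => ¬ dead y ∧ R u y)).card

open Classical in
lemma step_lemma {D n ω G : ℕ} {σ : ℤ} {ν : ℕ → Fin (16 * D) → Equiv.Perm ℤ} {dead : ℤ → Prop}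
    {R : ℤ → ℤ → Prop} {Ch P Q : ℕ → Fin (16 * D) → ℤ → Prop}
    (hsys : Sys D n ω σ ν dead R Ch P Q) (hω : 1 ≤ ω) (hD : 4 * ω * 2 ^ (G + 1) ≤ D)
    {u : ℤ} {T : Finset ℕ} (hT : GoodT D n Ch u T) (hDd : GoodD n dead u)
    {i j : ℕ} {r : ℤ} (hi : i < n) (hiT : i ∉ T) (hji : j ≤ i) (hij : i ≤ j + G)
    (hr : |u / 2 ^ j - r| ≤ 8) (hκ : |u / 2 ^ i - (r / 2 ^ (i - j) + σ)| ≤ 8)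
    (S : Finset ℤ) (hSB : S ⊆ Blk j r) (hSR : ∀ x ∈ S, ¬ dead x ∧ (x = u ∨ R u x))
    (hSc : 2 ^ j ≤ 2 * S.card) :
    Half dead R u i (r / 2 ^ (i - j) + σ) := by
  set κ := r / 2 ^ (i - j) with hκd
  by_contra hcon
  unfold Half at hcon
  push Not at hcon
  set Y' := (Blk i (κ + σ)).filter (fun y => ¬ dead y ∧ R u y) with hY'
  set Y := Y' ∪ (Blk i (κ + σ)).filter dead with hY
  have hdead := hDd i hi.le _ hκ
  have hSi : ∀ x ∈ S, x / 2 ^ i = κ := by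
    intro x hx
    have := mem_Blk.1 (hSB hx)
    rw [hκd, ← this, div_pow_pow]; congr 2; omega
  have hp2 : 2 ^ i ≤ 2 ^ j * 2 ^ G := by rw [← pow_add]; exact Nat.pow_le_pow_right (by norm_num) hij
  have hDG : 8 * 2 ^ G ≤ D := by
    calc 8 * 2 ^ G ≤ 4 * ω * 2 ^ (G + 1) := by rw [pow_succ]; nlinarith [Nat.one_le_two_pow (n := G)]
      _ ≤ D := hD
  have hYc : Y.card ≤ Y'.card + ((Blk i (κ + σ)).filter dead).card := Finset.card_union_le _ _
  have hmix := (hsys.mix i).2 κ S Y (fun x hx => mem_Blk.2 (hSi x hx))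
    (by intro y hy
        rcases Finset.mem_union.1 hy with h | h
        · exact (Finset.mem_filter.1 h).1
        · exact (Finset.mem_filter.1 h).1)
    (by omega)
    (by calc 2 * 2 ^ i ≤ 2 * (2 ^ j * 2 ^ G) := by gcongr
          _ ≤ 2 * ((2 * S.card) * 2 ^ G) := by gcongr
          _ = (4 * 2 ^ G) * S.card := by ring
          _ ≤ D * S.card := by gcongr; omega)
  have hsplit : ∀ s, (S.filter (fun x => ν i s x ∈ Y)).card + (S.filter (fun x => ¬ ν i s x ∈ Y)).card = S.card :=
    fun s => Finset.card_filter_add_card_filter_not _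
  have hsum : ∑ s, (S.filter (fun x => ν i s x ∈ Y)).card + ∑ s, (S.filter (fun x => ¬ ν i s x ∈ Y)).card
      = 16 * D * S.card := by
    rw [← Finset.sum_add_distrib, Finset.sum_congr rfl (fun s _ => hsplit s)]
    simp
  have hbd : ∀ s, (S.filter (fun x => ¬ ν i s x ∈ Y)).card ≤
      ((Blk j r).filter (fun x => Ch i s x)).card + ((Blk j r).filter (fun x => ¬ dead x ∧ P i s x)).card
        + ((Blk i (κ + σ)).filter (fun y => ¬ dead y ∧ Q i s y)).card := by
    intro s
    have h1 : S.filter (fun x => ¬ ν i s x ∈ Y) ⊆ ((Blk j r).filter (fun x => Ch i s x) ∪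
        (Blk j r).filter (fun x => ¬ dead x ∧ P i s x)) ∪ ((Blk i (κ + σ)).filter (fun y => ¬ dead y ∧ Q i s y)).image (ν i s).symm := by
      intro x hx
      obtain ⟨hx, hxY⟩ := Finset.mem_filter.1 hx
      have hb : ν i s x ∈ Blk i (κ + σ) := by
        rw [mem_Blk, (hsys.mix i).1, hSi x hx]
      have hnd : ¬ dead (ν i s x) := fun h => hxY (Finset.mem_union_right _ (Finset.mem_filter.2 ⟨hb, h⟩))
      have hnR : ¬ R x (ν i s x) := by
        intro h
        apply hxY
        apply Finset.mem_union_left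
        refine Finset.mem_filter.2 ⟨hb, hnd, ?_⟩
        rcases (hSR x hx).2 with h' | h'
        · rw [← h']; exact h
        · exact hsys.tr _ _ _ h' h
      rcases hsys.step i hi s x (hSR x hx).1 hnd with h | h | h | h
      · exact absurd h hnR
      · exact Finset.mem_union_left _ (Finset.mem_union_left _ (Finset.mem_filter.2 ⟨hSB hx, h⟩))
      · exact Finset.mem_union_left _ (Finset.mem_union_right _ (Finset.mem_filter.2 ⟨hSB hx, (hSR x hx).1, h⟩))
      · exact Finset.mem_union_right _ (Finset.mem_image.2 ⟨_, Finset.mem_filter.2 ⟨hb, hnd, h⟩, by simp⟩)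
    refine (Finset.card_le_card h1).trans ((Finset.card_union_le _ _).trans ?_)
    have h2 := Finset.card_union_le ((Blk j r).filter (fun x => Ch i s x)) ((Blk j r).filter (fun x => ¬ dead x ∧ P i s x))
    have h3 := Finset.card_image_le (s := (Blk i (κ + σ)).filter (fun y => ¬ dead y ∧ Q i s y)) (f := (ν i s).symm)
    omega
  have hswap : ∀ (B : Finset ℤ) (F : Fin (16 * D) → ℤ → Prop),
      ∑ s, (B.filter (fun x => F s x)).card = ∑ x ∈ B, (Finset.univ.filter (fun s => F s x)).card := by
    intro B F
    simp only [Finset.card_filter]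
    rw [Finset.sum_comm]
  have hcap : ∀ (B : Finset ℤ) (F : Fin (16 * D) → ℤ → Prop), (∀ x, ¬ dead x → (Finset.univ.filter (fun s => F s x)).card ≤ ω) →
      ∑ s, (B.filter (fun x => ¬ dead x ∧ F s x)).card ≤ B.card * ω := by
    intro B F hF
    have hs := hswap B (fun s x => ¬ dead x ∧ F s x)
    refine le_trans (le_of_eq ?_) (le_trans (le_of_eq hs) ?_)
    · refine Finset.sum_congr rfl (fun s _ => ?_)
      congr
    refine (Finset.sum_le_card_nsmul B _ ω ?_).trans (by simp)
    intro x _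
    by_cases hx : dead x
    · simp [hx]
    · simpa [hx] using hF x hx
  have htot := Finset.sum_le_sum (fun s (_ : s ∈ (Finset.univ : Finset (Fin (16 * D)))) => hbd s)
  rw [Finset.sum_add_distrib, Finset.sum_add_distrib, hswap] at htot
  have hc1 := hT i hi hiT j (by omega) r hr
  have hc2 := hcap (Blk j r) (P i) (hsys.hP i hi)
  have hc3 := hcap (Blk i (κ + σ)) (Q i) (hsys.hQ i hi)
  rw [card_Blk] at hc2 hc3
  have e1 : 2 ^ j * ω + 2 ^ i * ω ≤ 2 ^ j * (ω * 2 ^ (G + 1)) := by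
    have : 1 ≤ 2 ^ G := Nat.one_le_two_pow
    calc 2 ^ j * ω + 2 ^ i * ω ≤ 2 ^ j * ω * 2 ^ G + (2 ^ j * 2 ^ G) * ω := by
          have := Nat.le_mul_of_pos_right (2 ^ j * ω) (show 0 < 2 ^ G by omega)
          have := Nat.mul_le_mul_right ω hp2
          omega
      _ = _ := by ring
  have e2 : 2 ^ j * (4 * ω * 2 ^ (G + 1)) ≤ 2 ^ j * D := by gcongr
  have e3 : D * 2 ^ j ≤ D * (2 * S.card) := by gcongr
  have e4 : 15 * D * S.card = 15 * (D * S.card) := by ring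
  have e5 : 16 * D * S.card = 16 * (D * S.card) := by ring
  have e6 : D * (2 * S.card) = 2 * (D * S.card) := by ring
  have e7 : 2 ^ j * (4 * ω * 2 ^ (G + 1)) = 4 * (2 ^ j * (ω * 2 ^ (G + 1))) := by ring
  have e8 : 2 ^ j * D = D * 2 ^ j := by ring
  rw [e4] at hmix
  rw [e5] at hsum
  omega

open Classical in
lemma fwd_lemma {D n ω t : ℕ} {σ : ℤ} {ν : ℕ → Fin (16 * D) → Equiv.Perm ℤ} {dead : ℤ → Prop}
    {R : ℤ → ℤ → Prop} {Ch P Q : ℕ → Fin (16 * D) → ℤ → Prop} (hσ : σ = 1 ∨ σ = -1)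
    (hsys : Sys D n ω σ ν dead R Ch P Q) (hω : 1 ≤ ω) (hD : 4 * ω * 2 ^ (t + 2) ≤ D)
    {u : ℤ} {T : Finset ℕ} (hT : GoodT D n Ch u T) (hDd : GoodD n dead u) (htT : T.card ≤ t)
    (i : ℕ) (hi : i < n) (hiT : i ∉ T) :
    ∃ a : ℤ, 1 ≤ a ∧ a ≤ 2 ∧ Half dead R u i (u / 2 ^ i + σ * a) := by
  induction i using Nat.strong_induction_on with
  | _ i ih =>
  have hund : ¬ dead u := by
    intro h
    have := hDd 0 (Nat.zero_le _) u (by simp)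
    have h2 : u ∈ (Blk 0 u).filter dead := Finset.mem_filter.2 ⟨mem_Blk.2 (by simp), h⟩
    have h3 := Finset.card_pos.2 ⟨u, h2⟩
    rw [pow_zero] at this
    omega
  by_cases hex : ∃ j, j < i ∧ j ∉ T
  · -- largest such j
    let J := (Finset.range i).filter (fun j => j ∉ T)
    have hJ : J.Nonempty := by
      obtain ⟨j, h1, h2⟩ := hex
      exact ⟨j, Finset.mem_filter.2 ⟨Finset.mem_range.2 h1, h2⟩⟩
    have hm := J.max'_mem hJ
    set j := J.max' hJ with hj
    obtain ⟨hj1, hj2⟩ := Finset.mem_filter.1 hm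
    have hj1 := Finset.mem_range.1 hj1
    have hgap : i ≤ j + (t + 1) := by
      have hsub : Finset.Ioo j i ⊆ T := by
        intro x hx
        rw [Finset.mem_Ioo] at hx
        by_contra hxT
        have : x ∈ J := Finset.mem_filter.2 ⟨Finset.mem_range.2 hx.2, hxT⟩
        have := J.le_max' _ this
        omega
      have := Finset.card_le_card hsub
      rw [Nat.card_Ioo] at this
      omega
    obtain ⟨a, ha1, ha2, hH⟩ := ih j hj1 (by omega) hj2
    set r := u / 2 ^ j + σ * a with hr
    have hpow : (2 : ℤ) ≤ 2 ^ (i - j) := by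
      calc (2 : ℤ) = 2 ^ 1 := by norm_num
        _ ≤ 2 ^ (i - j) := pow_le_pow_right₀ (by norm_num) (by omega)
    have hui : u / 2 ^ i = u / 2 ^ j / 2 ^ (i - j) := by rw [div_pow_pow]; congr 2; omega
    have hκ : ∃ b : ℤ, 0 ≤ b ∧ b ≤ 1 ∧ r / 2 ^ (i - j) = u / 2 ^ i + σ * b := by
      rw [hui, hr]
      generalize u / 2 ^ j = x
      generalize (2 : ℤ) ^ (i - j) = p at hpow
      have hp : 0 < p := by linarith
      rcases hσ with rfl | rfl
      · have h1 : x / p ≤ (x + 1 * a) / p := Int.ediv_le_ediv hp (by linarith)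
        have h2 : (x + 1 * a) / p ≤ (x + 1 * p) / p := Int.ediv_le_ediv hp (by linarith)
        rw [Int.add_mul_ediv_right _ _ hp.ne'] at h2
        exact ⟨(x + 1 * a) / p - x / p, by linarith, by linarith, by ring⟩
      · have h1 : (x + -1 * a) / p ≤ x / p := Int.ediv_le_ediv hp (by linarith)
        have h2 : (x + (-1) * p) / p ≤ (x + -1 * a) / p := Int.ediv_le_ediv hp (by linarith)
        rw [Int.add_mul_ediv_right _ _ hp.ne'] at h2
        exact ⟨x / p - (x + -1 * a) / p, by linarith, by linarith, by ring⟩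
    obtain ⟨b, hb0, hb1, hb⟩ := hκ
    have hst := step_lemma hsys hω (G := t + 1) hD hT hDd (i := i) (j := j) (r := r) hi hiT hj1.le hgap
      (by rw [hr]; rcases hσ with rfl | rfl <;> rw [abs_le] <;> constructor <;> linarith)
      (by rw [hb]; rcases hσ with rfl | rfl <;> rw [abs_le] <;> constructor <;> linarith)
      ((Blk j r).filter (fun y => ¬ dead y ∧ R u y)) (Finset.filter_subset _ _)
      (fun x hx => ⟨(Finset.mem_filter.1 hx).2.1, Or.inr (Finset.mem_filter.1 hx).2.2⟩) (le_of_lt hH)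
    refine ⟨b + 1, by linarith, by linarith, ?_⟩
    rw [hb] at hst
    convert hst using 1
    ring
  · push Not at hex
    have hgap : i ≤ t := by
      have hsub : Finset.range i ⊆ T := fun x hx => hex x (Finset.mem_range.1 hx)
      have := Finset.card_le_card hsub
      rw [Finset.card_range] at this
      omega
    have hst := step_lemma hsys hω (G := t + 1) hD hT hDd (i := i) (j := 0) (r := u) hi hiT (by omega) (by omega)
      (by simp)
      (by simp only [Nat.sub_zero]; rcases hσ with rfl | rfl <;> rw [abs_le] <;> constructor <;> linarith)
      {u} (by intro x hx; rw [Finset.mem_singleton.1 hx, mem_Blk]; simp)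
      (fun x hx => by rw [Finset.mem_singleton.1 hx]; exact ⟨hund, Or.inl rfl⟩) (by simp)
    refine ⟨1, le_rfl, by norm_num, ?_⟩
    simpa using hst

open Classical in
lemma connect_lemma {D n ω t : ℕ} {ν : ℕ → Fin (16 * D) → Equiv.Perm ℤ} {dead : ℤ → Prop}
    {R : ℤ → ℤ → Prop} {Ch P Q : ℕ → Fin (16 * D) → ℤ → Prop}
    {ν' : ℕ → Fin (16 * D) → Equiv.Perm ℤ}
    {Ch' P' Q' : ℕ → Fin (16 * D) → ℤ → Prop}
    (hsys : Sys D n ω 1 ν dead R Ch P Q) 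
    (hsys' : Sys D n ω (-1) ν' dead (fun x y => R y x) Ch' P' Q') 
    (hω : 1 ≤ ω) (hD : 4 * ω * 2 ^ (t + 2) ≤ D)
    {u v : ℤ} {T : Finset ℕ} (hT : GoodT D n Ch u T) (hDd : GoodD n dead u) 
    (hT' : GoodT D n Ch' v T) (hDd' : GoodD n dead v) (htT : T.card ≤ t)
    (i : ℕ) (hi : i < n) (hiT : i ∉ T) (h1 : 2 ^ (i + 2) ≤ v - u) (h2 : v - u < 2 ^ (i + 3)) : R u v := by
  obtain ⟨a, ha1, ha2, hH⟩ := fwd_lemma (Or.inl rfl) hsys hω hD hT hDd htT i hi hiT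
  obtain ⟨b, hb1, hb2, hH'⟩ := fwd_lemma (Or.inr rfl) hsys' hω hD hT' hDd' htT i hi hiT
  have hp : (0 : ℤ) < 2 ^ i := by positivity
  have d1 : u / 2 ^ i + 4 ≤ v / 2 ^ i := by
    rw [← Int.add_mul_ediv_right _ _ hp.ne']
    apply Int.ediv_le_ediv hp
    rw [pow_add] at h1; linarith
  have d2 : v / 2 ^ i ≤ u / 2 ^ i + 8 := by
    rw [← Int.add_mul_ediv_right _ _ hp.ne']
    apply Int.ediv_le_ediv hp
    rw [pow_add] at h2; linarith
  have adv : ∀ r : ℕ, a + r ≤ 8 → Half dead R u i (u / 2 ^ i + (a + r)) := by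
    intro r
    induction r with
    | zero => intro _; simpa using hH
    | succ r ihr =>
      intro hr
      push_cast at hr
      have hprev := ihr (by linarith)
      have hr0 : (0 : ℤ) ≤ r := by positivity
      have hst := step_lemma hsys hω (G := t + 1) hD hT hDd (i := i) (j := i)
        (r := u / 2 ^ i + (a + r)) hi hiT le_rfl (by omega)
        (by rw [abs_le]; constructor <;> linarith)
        (by simp only [Nat.sub_self, pow_zero, Int.ediv_one]; rw [abs_le]; constructor <;> linarith)
        _ (Finset.filter_subset (fun y => ¬ dead y ∧ R u y) _)
        (fun x hx => ⟨(Finset.mem_filter.1 hx).2.1, Or.inr (Finset.mem_filter.1 hx).2.2⟩) (le_of_lt hprev)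
      simp only [Nat.sub_self, pow_zero, Int.ediv_one] at hst
      convert hst using 1
      push_cast; ring
  obtain ⟨r, hr⟩ := Int.eq_ofNat_of_zero_le (show 0 ≤ v / 2 ^ i - b - (u / 2 ^ i + a) by linarith)
  have hF := adv r (by linarith)
  have e : u / 2 ^ i + (a + r) = v / 2 ^ i + -1 * b := by linarith
  rw [e] at hF
  unfold Half at hF hH'
  simp only at hH'
  set B := Blk i (v / 2 ^ i + -1 * b)
  have hBc : B.card = 2 ^ i := card_Blk _ _
  by_contra hcon
  have hdis : Disjoint (B.filter (fun y => ¬ dead y ∧ R u y)) (B.filter (fun y => ¬ dead y ∧ R y v)) := by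
    rw [Finset.disjoint_left]
    intro y hy hy'
    exact hcon (hsys.tr _ _ _ (Finset.mem_filter.1 hy).2.2 (Finset.mem_filter.1 hy').2.2)
  have := Finset.card_le_card (Finset.union_subset (Finset.filter_subset (fun y => ¬ dead y ∧ R u y) B) (Finset.filter_subset (fun y => ¬ dead y ∧ R y v) B))
  rw [Finset.card_union_of_disjoint hdis] at this
  omega


open Classical in
lemma small_sets {α : Type*} (A : Finset α) (t : ℕ) :
    (A.powerset.filter (fun Z => Z.card ≤ t)).card ≤ (A.card + 1) ^ t := by
  induction t with
  | zero =>
    have : A.powerset.filter (fun Z => Z.card ≤ 0) ⊆ {∅} := by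
      intro Z hZ
      have := (Finset.mem_filter.1 hZ).2
      simpa using this
    simpa using Finset.card_le_card this
  | succ t ih =>
    set Pt := A.powerset.filter (fun Z => Z.card ≤ t) with hPt
    have : A.powerset.filter (fun Z => Z.card ≤ t + 1) ⊆
        Pt ∪ (Pt ×ˢ A).image (fun p => insert p.2 p.1) := by
      intro Z hZ
      obtain ⟨h1, h2⟩ := Finset.mem_filter.1 hZ
      rw [Finset.mem_powerset] at h1
      rcases Z.eq_empty_or_nonempty with rfl | ⟨a, ha⟩
      · exact Finset.mem_union_left _ (Finset.mem_filter.2 ⟨by simp, by simp⟩)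
      · apply Finset.mem_union_right
        refine Finset.mem_image.2 ⟨(Z.erase a, a), ?_, Finset.insert_erase ha⟩
        refine Finset.mem_product.2 ⟨Finset.mem_filter.2 ⟨?_, ?_⟩, h1 ha⟩
        · exact Finset.mem_powerset.2 ((Finset.erase_subset _ _).trans h1)
        · have := Finset.card_erase_of_mem ha
          simp only; omega
    calc _ ≤ _ := Finset.card_le_card this
      _ ≤ Pt.card + ((Pt ×ˢ A).image (fun p => insert p.2 p.1)).card := Finset.card_union_le _ _
      _ ≤ Pt.card + Pt.card * A.card := by
          have := Finset.card_image_le (s := Pt ×ˢ A) (f := fun p => insert p.2 p.1)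
          rw [Finset.card_product] at this
          omega
      _ = Pt.card * (A.card + 1) := by ring
      _ ≤ (A.card + 1) ^ t * (A.card + 1) := by gcongr
      _ = _ := by ring

lemma Sys.flip {D n ω : ℕ} {ν : ℕ → Fin (16 * D) → Equiv.Perm ℤ} {dead : ℤ → Prop}
    {R : ℤ → ℤ → Prop} {Ch P Q : ℕ → Fin (16 * D) → ℤ → Prop}
    (hsys : Sys D n ω 1 ν dead R Ch P Q) (hm : ∀ i, Mix D i (-1) (fun s => (ν i s).symm)) :
    Sys D n ω (-1) (fun i s => (ν i s).symm) dead (fun x y => R y x)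
      (fun i s y => Ch i s ((ν i s).symm y)) Q P where
  mix := hm
  tr := fun x y z h1 h2 => hsys.tr _ _ _ h2 h1
  step := by
    intro i hi s x h1 h2
    have := hsys.step i hi s ((ν i s).symm x) h2 (by simpa using h1)
    simp only [Equiv.apply_symm_apply] at this
    tauto
  hP := hsys.hQ
  hQ := hsys.hP

lemma sum_card_fib {D : ℕ} {E : ℕ} (Ch : Fin (16 * D) → ℤ → Prop) [∀ x, DecidablePred (fun s => Ch s x)]
    (hE : ∀ F : Finset (Fin (16 * D) × ℤ), (∀ p ∈ F, Ch p.1 p.2) → F.card ≤ E) (F : Finset ℤ) :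
    ∑ x ∈ F, (Finset.univ.filter (fun s => Ch s x)).card ≤ E := by
  classical
  rw [← Finset.card_sigma]
  have := hE ((F.sigma (fun x => Finset.univ.filter (fun s => Ch s x))).image (fun p => (p.2, p.1)))
    (by intro p hp
        obtain ⟨q, hq, rfl⟩ := Finset.mem_image.1 hp
        simpa using (Finset.mem_sigma.1 hq).2)
  rwa [Finset.card_image_of_injective] at this
  rintro ⟨a, b⟩ ⟨c, d⟩ h
  simp only [Prod.mk.injEq] at h
  obtain ⟨rfl, rfl⟩ := h
  rfl

open Classical in
theorem cluster_thm {D n ω t w Etot dd : ℕ} {ν : ℕ → Fin (16 * D) → Equiv.Perm ℤ} {dead : ℤ → Prop}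
    {R : ℤ → ℤ → Prop} {Ch P Q : ℕ → Fin (16 * D) → ℤ → Prop}
    (hsys : Sys D n ω 1 ν dead R Ch P Q) (hm : ∀ i, Mix D i (-1) (fun s => (ν i s).symm))
    (hω : 1 ≤ ω) (hD : 4 * ω * 2 ^ (t + 2) ≤ D)
    (E : ℕ → ℕ)
    (hE : ∀ i < n, ∀ F : Finset (Fin (16 * D) × ℤ), (∀ p ∈ F, Ch i p.1 p.2) → F.card ≤ E i)
    (hEt : ∑ i ∈ Finset.range n, E i ≤ Etot)
    (hdd : ∀ F : Finset ℤ, (∀ x ∈ F, dead x) → F.card ≤ dd)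
    (h1 : 544 * Etot ≤ (t + 1) * D * 2 ^ n) (h2 : 4352 * dd ≤ 2 ^ n)
    (hw : 8 * (3 * n + 1) ^ t * w ≤ 2 ^ n) :
    ∃ W : Finset ℤ, W ⊆ Finset.Ico 0 (2 ^ n) ∧ w ≤ W.card ∧ (∀ u ∈ W, ¬ dead u) ∧
      ∀ u ∈ W, ∀ v ∈ W, u < v → R u v := by
  have hsys' := hsys.flip hm
  set U : Finset ℤ := Finset.Ico 0 (2 ^ n) with hU
  have hUc : U.card = 2 ^ n := by
    rw [hU, Int.card_Ico, sub_zero]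
    exact Int.toNat_natCast (2 ^ n)
  set cO : ℕ → ℤ → ℕ := fun i x => 4 * (Finset.univ.filter (fun s => Ch i s x)).card with hcO
  set cI : ℕ → ℤ → ℕ := fun i x => 4 * (Finset.univ.filter (fun s => Ch i s ((ν i s).symm x))).card with hcI
  set bO : ℕ → ℤ → Prop := fun i u => ∃ j ≤ n, ∃ k' : ℤ, |u / 2 ^ j - k'| ≤ 8 ∧ D * 2 ^ j ≤ ∑ x ∈ Blk j k', cO i x with hbO
  set bI : ℕ → ℤ → Prop := fun i u => ∃ j ≤ n, ∃ k' : ℤ, |u / 2 ^ j - k'| ≤ 8 ∧ D * 2 ^ j ≤ ∑ x ∈ Blk j k', cI i x with hbI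
  set T : ℤ → Finset ℕ := fun u => (Finset.range n).filter (fun i => bO i u ∨ bI i u) with hT
  -- per-level count
  have hlev : ∀ i ∈ Finset.range n, (U.filter (fun u => bO i u ∨ bI i u)).card * D ≤ 136 * E i := by
    intro i hi
    have hi := Finset.mem_range.1 hi
    have m1 := max_lemma n D (4 * E i) (cO i) U (by
      intro F
      rw [hcO, ← Finset.mul_sum]
      exact Nat.mul_le_mul_left _ (sum_card_fib (Ch i) (hE i hi) F))
    have m2 := max_lemma n D (4 * E i) (cI i) U (by
      intro F
      rw [hcI, ← Finset.mul_sum]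
      refine Nat.mul_le_mul_left _ (sum_card_fib (fun s x => Ch i s ((ν i s).symm x)) ?_ F)
      intro F hF
      have := hE i hi (F.image (fun p => (p.1, (ν i p.1).symm p.2))) (by
        intro p hp
        obtain ⟨q, hq, rfl⟩ := Finset.mem_image.1 hp
        exact hF q hq)
      rwa [Finset.card_image_of_injective] at this
      rintro ⟨a, b⟩ ⟨c, d⟩ h
      simp only [Prod.mk.injEq] at h
      obtain ⟨rfl, h⟩ := h
      simpa using h)
    have hle : (U.filter (fun u => bO i u ∨ bI i u)).card ≤ (U.filter (fun u => bO i u)).card + (U.filter (fun u => bI i u)).card := by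
      rw [Finset.filter_or]; exact Finset.card_union_le _ _
    have m1' : (U.filter (fun u => bO i u)).card * D ≤ 17 * (4 * E i) := m1
    have m2' : (U.filter (fun u => bI i u)).card * D ≤ 17 * (4 * E i) := m2
    have := Nat.mul_le_mul_right D hle
    rw [add_mul] at this
    omega
  have hTsum : (∑ u ∈ U, (T u).card) * D ≤ 136 * Etot := by
    have : ∑ u ∈ U, (T u).card = ∑ i ∈ Finset.range n, (U.filter (fun u => bO i u ∨ bI i u)).card := by
      simp only [hT, Finset.card_filter]
      rw [Finset.sum_comm]
    rw [this, Finset.sum_mul]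
    calc _ ≤ ∑ i ∈ Finset.range n, 136 * E i := Finset.sum_le_sum hlev
      _ ≤ _ := by rw [← Finset.mul_sum]; gcongr
  have hDpos : 0 < D := by
    have : 0 < 4 * ω * 2 ^ (t + 2) := by positivity
    omega
  have hB1 : 4 * (U.filter (fun u => ¬ (T u).card ≤ t)).card ≤ 2 ^ n := by
    have a1 : (U.filter (fun u => ¬ (T u).card ≤ t)).card * (t + 1) ≤ ∑ u ∈ U, (T u).card := by
      calc _ = ∑ u ∈ U.filter (fun u => ¬ (T u).card ≤ t), (t + 1) := by simp
        _ ≤ ∑ u ∈ U.filter (fun u => ¬ (T u).card ≤ t), (T u).card := Finset.sum_le_sum (fun u hu => by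
            have := (Finset.mem_filter.1 hu).2; omega)
        _ ≤ _ := Finset.sum_le_sum_of_subset (Finset.filter_subset _ _)
    have a2 := Nat.mul_le_mul_right D a1
    have hpos : 0 < (t + 1) * D := by positivity
    apply Nat.le_of_mul_le_mul_left _ hpos
    calc (t + 1) * D * (4 * (U.filter (fun u => ¬ (T u).card ≤ t)).card)
        = 4 * ((U.filter (fun u => ¬ (T u).card ≤ t)).card * (t + 1) * D) := by ring
      _ ≤ 4 * (136 * Etot) := Nat.mul_le_mul_left 4 (a2.trans hTsum)
      _ = 544 * Etot := by ring
      _ ≤ _ := h1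
  have hB2 : 4 * (U.filter (fun u => ¬ GoodD n dead u)).card ≤ 2 ^ n := by
    have m := max_lemma n 1 (64 * dd) (fun x => if dead x then 64 else 0) U (by
      intro F
      rw [← Finset.sum_filter]
      have := hdd (F.filter (fun a => dead a)) (fun x hx => (Finset.mem_filter.1 hx).2)
      simp only [Finset.sum_const, smul_eq_mul]
      omega)
    have : (U.filter (fun u => ¬ GoodD n dead u)).card ≤ _ := Finset.card_le_card (t := U.filter (fun u => ∃ j ≤ n, ∃ k' : ℤ, |u / 2 ^ j - k'| ≤ 8 ∧
        1 * 2 ^ j ≤ ∑ x ∈ Blk j k', (if dead x then 64 else 0))) (by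
      intro u hu
      obtain ⟨hu, hg⟩ := Finset.mem_filter.1 hu
      refine Finset.mem_filter.2 ⟨hu, ?_⟩
      unfold GoodD at hg
      push Not at hg
      obtain ⟨j, hj, k', hk, hc⟩ := hg
      refine ⟨j, hj, k', hk, ?_⟩
      rw [← Finset.sum_filter]
      have hc' : 2 ^ j ≤ 64 * ((Blk j k').filter (fun a => dead a)).card := hc
      simp only [Finset.sum_const, smul_eq_mul]
      omega)
    omega
  set Gd := U.filter (fun u => (T u).card ≤ t ∧ GoodD n dead u) with hGd
  have hGc : 2 ^ n ≤ 2 * Gd.card := by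
    have : U ⊆ Gd ∪ (U.filter (fun u => ¬ (T u).card ≤ t) ∪ U.filter (fun u => ¬ GoodD n dead u)) := by
      intro u hu
      simp only [hGd, Finset.mem_union, Finset.mem_filter]
      tauto
    have := Finset.card_le_card this
    have c1 := Finset.card_union_le Gd (U.filter (fun u => ¬ (T u).card ≤ t) ∪ U.filter (fun u => ¬ GoodD n dead u))
    have c2 := Finset.card_union_le (U.filter (fun u => ¬ (T u).card ≤ t)) (U.filter (fun u => ¬ GoodD n dead u))
    omega
  -- colours
  set A : Finset (ℕ × ℤ) := Finset.range n ×ˢ Finset.Ico (0:ℤ) 3 with hA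
  have hAc : A.card = 3 * n := by rw [hA, Finset.card_product]; simp [mul_comm]
  set col : ℤ → Finset (ℕ × ℤ) × ℤ := fun u => ((T u).image (fun i => (i, u / 2 ^ (i + 2) % 3)), u % 4) with hcol
  set C := (A.powerset.filter (fun Z => Z.card ≤ t)) ×ˢ Finset.Ico (0:ℤ) 4 with hC
  have hCc : C.card ≤ 4 * (3 * n + 1) ^ t := by
    rw [hC, Finset.card_product]
    have := small_sets A t
    rw [hAc] at this
    rw [Int.card_Ico]
    have e4 : ((4:ℤ) - 0).toNat = 4 := rfl
    rw [e4]
    omega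
  have hmaps : ∀ u ∈ Gd, col u ∈ C := by
    intro u hu
    obtain ⟨hu, hu1, hu2⟩ := Finset.mem_filter.1 hu
    refine Finset.mem_product.2 ⟨Finset.mem_filter.2 ⟨Finset.mem_powerset.2 ?_, Finset.card_image_le.trans hu1⟩, ?_⟩
    · intro p hp
      obtain ⟨i, hi, rfl⟩ := Finset.mem_image.1 hp
      refine Finset.mem_product.2 ⟨(Finset.mem_filter.1 hi).1, Finset.mem_Ico.2 ⟨?_, ?_⟩⟩
      · simp only; omega
      · simp only; omega
    · simp only [hcol, Finset.mem_Ico]; omega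
  have hCne : C.Nonempty := ⟨(∅, 0), by simp [hC]⟩
  obtain ⟨y, hy, hyc⟩ := Finset.exists_le_card_fiber_of_mul_le_card_of_maps_to hmaps hCne (n := w) (by
    have : C.card * w ≤ 4 * (3 * n + 1) ^ t * w := Nat.mul_le_mul_right _ hCc
    have e : 8 * (3 * n + 1) ^ t * w = 2 * (4 * (3 * n + 1) ^ t * w) := by ring
    omega)
  refine ⟨Gd.filter (fun u => col u = y), ?_, hyc, ?_, ?_⟩
  · intro u hu; exact (Finset.mem_filter.1 (Finset.mem_filter.1 hu).1).1
  · intro u hu hdu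
    obtain ⟨hu, -⟩ := Finset.mem_filter.1 hu
    have hg := (Finset.mem_filter.1 hu).2.2
    have := hg 0 (Nat.zero_le _) u (by simp)
    have h2 : u ∈ (Blk 0 u).filter dead := Finset.mem_filter.2 ⟨mem_Blk.2 (by simp), hdu⟩
    have h3 := Finset.card_pos.2 ⟨u, h2⟩
    rw [pow_zero] at this
    omega
  · intro u hu v hv huv
    obtain ⟨hu, hcu⟩ := Finset.mem_filter.1 hu
    obtain ⟨hv, hcv⟩ := Finset.mem_filter.1 hv
    obtain ⟨huU, htu, hgu⟩ := Finset.mem_filter.1 hu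
    obtain ⟨hvU, htv, hgv⟩ := Finset.mem_filter.1 hv
    have hcuv : col u = col v := hcu.trans hcv.symm
    simp only [hcol, Prod.mk.injEq] at hcuv
    obtain ⟨hZ, hmod⟩ := hcuv
    have hTT : T u = T v := by
      have := congrArg (Finset.image Prod.fst) hZ
      simpa [Finset.image_image, Function.comp_def] using this
    have hd4 : 4 ≤ v - u := by omega
    obtain ⟨d, hd⟩ := Int.eq_ofNat_of_zero_le (show 0 ≤ v - u by omega)
    have hd4' : 4 ≤ d := by omega
    have hlog : 2 ≤ Nat.log 2 d := Nat.le_log_of_pow_le (by norm_num) (by omega)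
    obtain ⟨i, hi⟩ := Nat.exists_eq_add_of_le hlog
    have l1 : 2 ^ (i + 2) ≤ d := by
      have := Nat.pow_log_le_self 2 (show d ≠ 0 by omega)
      rw [hi] at this; rwa [add_comm]
    have l2 : d < 2 ^ (i + 3) := by
      have := Nat.lt_pow_succ_log_self (b := 2) (by norm_num) d
      rw [hi] at this
      convert this using 2; omega
    have l1' : (2 : ℤ) ^ (i + 2) ≤ v - u := by rw [hd]; exact_mod_cast l1
    have l2' : v - u < (2 : ℤ) ^ (i + 3) := by rw [hd]; exact_mod_cast l2
    have hin : i < n := by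
      rw [hU, Finset.mem_Ico] at huU hvU
      have : (2 : ℤ) ^ (i + 2) < 2 ^ n := by linarith
      have := (pow_lt_pow_iff_right₀ (by norm_num : (1:ℤ) < 2)).1 this
      omega
    have hiT : i ∉ T u := by
      intro hi
      have hmem : (i, u / 2 ^ (i + 2) % 3) ∈ (T v).image (fun i => (i, v / 2 ^ (i + 2) % 3)) := by
        rw [← hZ]; exact Finset.mem_image.2 ⟨i, hi, rfl⟩
      obtain ⟨i', _, he⟩ := Finset.mem_image.1 hmem
      simp only [Prod.mk.injEq] at he
      obtain ⟨rfl, he⟩ := he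
      have hp : (0 : ℤ) < 2 ^ (i' + 2) := by positivity
      have g1 : u / 2 ^ (i' + 2) + 1 ≤ v / 2 ^ (i' + 2) := by
        rw [← Int.add_mul_ediv_right _ _ hp.ne']
        exact Int.ediv_le_ediv hp (by linarith)
      have g2 : v / 2 ^ (i' + 2) ≤ u / 2 ^ (i' + 2) + 2 := by
        rw [← Int.add_mul_ediv_right _ _ hp.ne']
        refine Int.ediv_le_ediv hp ?_
        have : (2 : ℤ) ^ (i' + 3) = 2 * 2 ^ (i' + 2) := by ring
        linarith
      omega
    refine connect_lemma hsys hsys' hω hD (T := T u) (t := t) ?_ hgu ?_ hgv htu i hin hiT l1' l2'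
    · intro i hi hiT j hj k' hk
      by_contra hc
      push Not at hc
      apply hiT
      refine Finset.mem_filter.2 ⟨Finset.mem_range.2 hi, Or.inl ⟨j, hj, k', hk, ?_⟩⟩
      rw [hcO, ← Finset.mul_sum]; exact hc
    · rw [hTT]
      intro i hi hiT j hj k' hk
      by_contra hc
      push Not at hc
      apply hiT
      refine Finset.mem_filter.2 ⟨Finset.mem_range.2 hi, Or.inr ⟨j, hj, k', hk, ?_⟩⟩
      rw [hcI, ← Finset.mul_sum]; exact hc


/-- existence of an alive path with `k` edges ending at `v` -/
def reach {V : Type*} (Adj : V → V → Prop) (al : V → Prop) : ℕ → V → Prop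
  | 0, v => al v
  | k + 1, v => al v ∧ ∃ u, Adj u v ∧ reach Adj al k u

lemma reach_al {V : Type*} {Adj : V → V → Prop} {al : V → Prop} {k : ℕ} {v : V}
    (h : reach Adj al k v) : al v := by
  cases k with
  | zero => exact h
  | succ k => exact h.1

lemma reach_mono {V : Type*} {Adj : V → V → Prop} {al : V → Prop} {k : ℕ} :
    ∀ {v : V}, reach Adj al (k + 1) v → reach Adj al k v := by
  induction k with
  | zero => intro v h; exact h.1
  | succ k ih =>
    intro v h
    obtain ⟨h1, u, h2, h3⟩ := h
    exact ⟨h1, u, h2, ih h3⟩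

lemma reach_trans {V : Type*} {Adj : V → V → Prop} {al : V → Prop} {k : ℕ} {u v : V}
    (hu : reach Adj al k u) (h : Relation.TransGen (fun x y => Adj x y ∧ al y) u v) :
    reach Adj al (k + 1) v := by
  induction h with
  | single h => exact ⟨h.2, u, h.1, hu⟩
  | tail _ h ih => exact ⟨h.2, _, h.1, reach_mono ih⟩

lemma reach_list {V : Type*} {Adj : V → V → Prop} {al : V → Prop} {k : ℕ} :
    ∀ {v : V}, reach Adj al k v → ∃ p : List V, PathIn Adj p ∧ (∀ x ∈ p, al x) ∧ p.length = k + 1 ∧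
      p.getLast? = some v := by
  induction k with
  | zero => intro v h; exact ⟨[v], ⟨by simp, List.isChain_singleton _⟩, by intro x hx; rw [List.mem_singleton.1 hx]; exact h, rfl, rfl⟩
  | succ k ih =>
    intro v h
    obtain ⟨h1, u, h2, h3⟩ := h
    obtain ⟨p, hp1, hp2, hp3, hp4⟩ := ih h3
    refine ⟨p ++ [v], ⟨by simp, ?_⟩, ?_, by simp [hp3], by simp⟩
    · refine List.isChain_append.2 ⟨hp1.2, List.isChain_singleton _, ?_⟩
      intro x hx y hy
      rw [hp4] at hx
      simp at hx hy
      rw [← hx, ← hy]; exact h2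
    · intro x hx
      rcases List.mem_append.1 hx with h | h
      · exact hp2 x h
      · rw [List.mem_singleton.1 h]; exact h1

lemma reach_chain {V : Type*} {Adj : V → V → Prop} {al : V → Prop} (g : ℤ → V) (W : Finset ℤ)
    (hal : ∀ u ∈ W, al (g u))
    (hW : ∀ u ∈ W, ∀ v ∈ W, u < v → Relation.TransGen (fun x y => Adj x y ∧ al y) (g u) (g v))
    (k : ℕ) (hk : k + 1 ≤ W.card) : ∃ v ∈ W, reach Adj al k (g v) := by
  have key : ∀ W' : Finset ℤ, W' ⊆ W → ∀ h : W'.Nonempty, reach Adj al (W'.card - 1) (g (W'.max' h)) := by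
    intro W'
    induction W' using Finset.induction_on_max with
    | empty => intro _ h; exact absurd h (by simp)
    | insert a s hs ih =>
      intro hsub h
      have hmax : (insert a s).max' h = a := by
        apply le_antisymm
        · apply Finset.max'_le
          intro y hy
          rcases Finset.mem_insert.1 hy with rfl | hy
          · exact le_rfl
          · exact (hs y hy).le
        · exact Finset.le_max' _ _ (Finset.mem_insert_self _ _)
      have ha : a ∉ s := fun h => lt_irrefl _ (hs a h)
      rw [hmax, Finset.card_insert_of_notMem ha, Nat.add_sub_cancel]
      rcases s.eq_empty_or_nonempty with rfl | hne
      · exact hal a (hsub (by simp))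
      · have h1 := ih (fun x hx => hsub (Finset.mem_insert_of_mem hx)) hne
        have h2 := reach_trans h1 (hW _ (hsub (Finset.mem_insert_of_mem (s.max'_mem hne))) a
          (hsub (Finset.mem_insert_self _ _)) (hs _ (s.max'_mem hne)))
        have : s.card - 1 + 1 = s.card := by have := hne.card_pos; omega
        rwa [this] at h2
  have hne : W.Nonempty := Finset.card_pos.1 (by omega)
  refine ⟨W.max' hne, W.max'_mem hne, ?_⟩
  have h := key W (subset_refl _) hne
  obtain ⟨r, hr⟩ := Nat.exists_eq_add_of_le (show k ≤ W.card - 1 by omega)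
  rw [hr] at h
  clear hr key
  induction r with
  | zero => exact h
  | succ r ih => exact ih (reach_mono h)

/-- reduced graph -/
def redAdj {V : Type*} (Adj : V → V → Prop) (δ : V → ℕ) (ι : ∀ v, {u // Adj u v} → Fin (δ v)) :
    (Σ v, Fin (δ v)) → (Σ v, Fin (δ v)) → Prop := fun x y =>
  (x.1 = y.1 ∧ (x.2 : ℕ) + 1 = y.2) ∨
  (∃ h : Adj x.1 y.1, (x.2 : ℕ) + 1 = δ x.1 ∧ y.2 = ι y.1 ⟨x.1, h⟩)

theorem reduction {V : Type} [Fintype V] [DecidableEq V] (Adj : V → V → Prop) (δ : V → ℕ)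
    (rank : V → ℤ) (hrank : ∀ u v, Adj u v → rank u < rank v)
    (hδ : ∀ v, 1 ≤ δ v) (hin : ∀ v, Nat.card {u // Adj u v} ≤ δ v) (e d : ℕ)
    (hR : ∀ S : Finset V, S.card ≤ e → ∃ v, reach Adj (fun x => x ∉ S) d v) :
    ∃ G : Dig, Acyclic G.Adj ∧ Nat.card G.V = ∑ v, δ v ∧ (∀ x, indeg G.Adj x ≤ 2) ∧
      DepthRobust G.Adj e d := by
  classical
  have hι : ∀ v, ∃ f : {u // Adj u v} → Fin (δ v), Function.Injective f := by
    intro v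
    have : Fintype.card {u // Adj u v} ≤ Fintype.card (Fin (δ v)) := by
      rw [Fintype.card_fin, ← Nat.card_eq_fintype_card]; exact hin v
    obtain ⟨f⟩ := Function.Embedding.nonempty_of_card_le this
    exact ⟨f, f.injective⟩
  choose ι hι using hι
  refine ⟨⟨(Σ v, Fin (δ v)), redAdj Adj δ ι⟩, ?_, ?_, ?_, ?_⟩
  · intro x hx
    have : ∀ y, Relation.TransGen (redAdj Adj δ ι) x y →
        rank x.1 < rank y.1 ∨ (rank x.1 = rank y.1 ∧ (x.2 : ℕ) < y.2) := by
      have one : ∀ y z, redAdj Adj δ ι y z → rank y.1 < rank z.1 ∨ (rank y.1 = rank z.1 ∧ (y.2 : ℕ) < z.2) := by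
        intro y z h
        rcases h with ⟨h1, h2⟩ | ⟨h, _⟩
        · right; exact ⟨by rw [h1], by omega⟩
        · left; exact hrank _ _ h
      intro y hy
      induction hy with
      | single h => exact one _ _ h
      | tail _ h ih => 
        have := one _ _ h
        omega
    have := this x hx
    omega
  · simp
  · intro x
    unfold indeg
    show Nat.card {u // redAdj Adj δ ι u x} ≤ 2
    let c : {u // redAdj Adj δ ι u x} → Bool := fun u => decide (u.1.1 = x.1 ∧ (u.1.2 : ℕ) + 1 = x.2)
    have hc : Function.Injective c := by
      rintro ⟨⟨u, a⟩, hu⟩ ⟨⟨v, b⟩, hv⟩ h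
      obtain ⟨x, k⟩ := x
      simp only [c, decide_eq_decide] at h
      rw [Subtype.mk.injEq]
      by_cases h1 : u = x ∧ (a : ℕ) + 1 = k
      · have h2 := h.1 h1
        obtain ⟨rfl, h1⟩ := h1
        obtain ⟨rfl, h2⟩ := h2
        have : a = b := Fin.ext (by omega)
        rw [this]
      · have h2 := fun h' => h1 (h.2 h')
        rcases hu with hu | ⟨hu, hu1, hu2⟩
        · exact absurd hu h1
        rcases hv with hv | ⟨hv, hv1, hv2⟩
        · exact absurd hv h2
        simp only at hu hu1 hu2 hv hv1 hv2
        have := hι x (hu2.symm.trans hv2)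
        rw [Subtype.mk.injEq] at this
        subst this
        have : a = b := Fin.ext (by omega)
        rw [this]
    calc Nat.card {u // redAdj Adj δ ι u x} ≤ Nat.card Bool := Nat.card_le_card_of_injective c hc
      _ = 2 := by simp
  · intro S hS
    set S0 := S.image Sigma.fst with hS0
    obtain ⟨v, hv⟩ := hR S0 (Finset.card_image_le.trans hS)
    let last : V → (Σ v, Fin (δ v)) := fun v => ⟨v, ⟨δ v - 1, by have := hδ v; omega⟩⟩
    have hal : ∀ x : (Σ v, Fin (δ v)), x.1 ∉ S0 → x ∉ S := fun x hx h => hx (Finset.mem_image_of_mem _ h)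
    have hint : ∀ v, v ∉ S0 → ∀ (r : ℕ) (a b : Fin (δ v)), (a : ℕ) + r = b →
        Relation.ReflTransGen (fun x y => redAdj Adj δ ι x y ∧ y ∉ S) ⟨v, a⟩ ⟨v, b⟩ := by
      intro v hv r
      induction r with
      | zero => intro a b h; have : a = b := Fin.ext (by omega); rw [this]
      | succ r ih =>
        intro a b h
        have hb := b.2
        exact (ih a ⟨a + r, by omega⟩ rfl).tail ⟨Or.inl ⟨rfl, by simp only; omega⟩, hal _ hv⟩
    have htr : ∀ u v, Adj u v → v ∉ S0 → Relation.TransGen (fun x y => redAdj Adj δ ι x y ∧ y ∉ S) (last u) (last v) := by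
      intro u v huv hv
      have h1 : redAdj Adj δ ι (last u) ⟨v, ι v ⟨u, huv⟩⟩ := by
        right
        refine ⟨huv, ?_, rfl⟩
        have := hδ u
        simp only [last]; omega
      refine Relation.TransGen.head' ⟨h1, hal _ hv⟩ ?_
      refine hint v hv (δ v - 1 - (ι v ⟨u, huv⟩)) _ _ ?_
      have := (ι v ⟨u, huv⟩).2
      simp only; omega
    have hlift : ∀ k v, reach Adj (fun x => x ∉ S0) k v → reach (redAdj Adj δ ι) (fun x => x ∉ S) k (last v) := by
      intro k
      induction k with
      | zero => intro v h; exact hal _ h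
      | succ k ih =>
        intro v h
        obtain ⟨h1, u, h2, h3⟩ := h
        exact reach_trans (ih u h3) (htr u v h2 h1)
    obtain ⟨p, hp1, hp2, hp3, _⟩ := reach_list (hlift d v hv)
    exact ⟨p, hp1, hp2, hp3⟩


open Classical in
lemma rs_aux {L : ℕ} {H : Type*} (n : ℕ) (f : ℕ → Fin L → H)
    (hf : ∀ i < n, ∀ i' < n, i ≠ i' → ∀ s s', f i s = f i' s → f i s' = f i' s' → s = s')
    (X : Finset (Fin L × H)) (H' : Finset ℕ) (hH : H' ⊆ Finset.range n) :
    2 * ∑ i ∈ H', (Finset.univ.filter (fun s => (s, f i s) ∈ X)).card ≤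
      2 * (H'.biUnion (fun i => (Finset.univ.filter (fun s => (s, f i s) ∈ X)).image (fun s => (s, f i s)))).card
        + H'.card * (H'.card - 1) := by
  induction H' using Finset.induction_on with
  | empty => simp
  | insert a s ha ih =>
    have ih := ih (fun x hx => hH (Finset.mem_insert_of_mem hx))
    have han : a < n := Finset.mem_range.1 (hH (Finset.mem_insert_self _ _))
    rw [Finset.sum_insert ha, Finset.card_insert_of_notMem ha, Finset.biUnion_insert]
    set Xa := (Finset.univ.filter (fun s => (s, f a s) ∈ X)).image (fun s => (s, f a s)) with hXa
    set Un := s.biUnion (fun i => (Finset.univ.filter (fun s => (s, f i s) ∈ X)).image (fun s => (s, f i s))) with hUn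
    have h1 : Xa.card = (Finset.univ.filter (fun s => (s, f a s) ∈ X)).card := by
      apply Finset.card_image_of_injective
      intro x y h; exact (Prod.mk.inj h).1
    have h2 : (Xa ∪ Un).card + (Xa ∩ Un).card = Xa.card + Un.card := Finset.card_union_add_card_inter _ _
    have h3 : (Xa ∩ Un).card ≤ s.card := by
      have hsel : ∀ p ∈ Xa ∩ Un, ∃ i ∈ s, p.2 = f i p.1 ∧ p.2 = f a p.1 := by
        intro p hp
        obtain ⟨hp1, hp2⟩ := Finset.mem_inter.1 hp
        obtain ⟨i, hi, hp3⟩ := Finset.mem_biUnion.1 hp2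
        obtain ⟨x, _, rfl⟩ := Finset.mem_image.1 hp3
        obtain ⟨y, _, hy⟩ := Finset.mem_image.1 hp1
        obtain ⟨rfl, h⟩ := Prod.mk.inj hy
        exact ⟨i, hi, rfl, h.symm⟩
      choose! g hg1 hg2 using hsel
      apply Finset.card_le_card_of_injOn g hg1
      intro p hp p' hp' hgg
      have e1 := hg2 p hp
      have e2 := hg2 p' hp'
      rw [← hgg] at e2
      have hne : g p ≠ a := fun h => ha (h ▸ hg1 p hp)
      have hgn : g p < n := Finset.mem_range.1 (hH (Finset.mem_insert_of_mem (hg1 p hp)))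
      have := hf _ hgn a han hne p.1 p'.1 (e1.1.symm.trans e1.2) (e2.1.symm.trans e2.2)
      refine Prod.ext this ?_
      rw [e1.2, e2.2, this]
    have h4 : (s.card + 1) * (s.card + 1 - 1) = s.card * (s.card - 1) + 2 * s.card := by
      rcases Nat.eq_zero_or_pos s.card with h | h
      · rw [h]
      · obtain ⟨c, hc⟩ := Nat.exists_eq_add_of_le h
        rw [hc]; simp; ring
    rw [h4]
    omega

open Classical in
lemma rs_lemma {L : ℕ} {H : Type*} (n ω : ℕ) (f : ℕ → Fin L → H)
    (hf : ∀ i < n, ∀ i' < n, i ≠ i' → ∀ s s', f i s = f i' s → f i s' = f i' s' → s = s')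
    (X : Finset (Fin L × H)) (hX : 2 * X.card < ω * ω) :
    ∑ i ∈ (Finset.range n).filter (fun i => ω ≤ (Finset.univ.filter (fun s => (s, f i s) ∈ X)).card),
      (Finset.univ.filter (fun s => (s, f i s) ∈ X)).card ≤ 2 * X.card := by
  set β : ℕ → ℕ := fun i => (Finset.univ.filter (fun s => (s, f i s) ∈ X)).card with hβ
  set Hv := (Finset.range n).filter (fun i => ω ≤ β i) with hHv
  have key : ∀ H' ⊆ Hv, 2 * ∑ i ∈ H', β i ≤ 2 * X.card + H'.card * (H'.card - 1) := by
    intro H' hH'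
    refine (rs_aux n f hf X H' (hH'.trans (Finset.filter_subset _ _))).trans ?_
    gcongr
    intro p hp
    obtain ⟨i, _, hp⟩ := Finset.mem_biUnion.1 hp
    obtain ⟨s, hs, rfl⟩ := Finset.mem_image.1 hp
    simpa using hs
  have low : ∀ H' ⊆ Hv, H'.card * ω ≤ ∑ i ∈ H', β i := by
    intro H' hH'
    have := Finset.card_nsmul_le_sum H' β ω (fun i hi => (Finset.mem_filter.1 (hH' hi)).2)
    simpa using this
  have hlt : Hv.card < ω := by
    by_contra hge
    push Not at hge
    obtain ⟨H', hH', hc⟩ := Finset.exists_subset_card_eq hge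
    have h1 := key H' hH'
    have h2 := low H' hH'
    rw [hc] at h1 h2
    have : ω * (ω - 1) ≤ ω * ω := Nat.mul_le_mul_left _ (by omega)
    omega
  have h1 := key Hv (subset_refl _)
  have h2 := low Hv (subset_refl _)
  have : Hv.card * (Hv.card - 1) ≤ Hv.card * ω := Nat.mul_le_mul_left _ (by omega)
  have h3 : ∑ i ∈ Hv, β i ≤ 2 * X.card := by omega
  exact h3

/-- hub of level `i` on lane `s` -/
def hub (q : ℕ) (i s : ℕ) : ZMod q := ((i / q : ℕ) : ZMod q) * (s : ZMod q) + ((i % q : ℕ) : ZMod q)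

lemma natCast_inj_lt {q a b : ℕ} (ha : a < q) (hb : b < q) (h : (a : ZMod q) = b) : a = b := by
  rw [ZMod.natCast_eq_natCast_iff'] at h
  rwa [Nat.mod_eq_of_lt ha, Nat.mod_eq_of_lt hb] at h

lemma hub_sep {q : ℕ} (hq : q.Prime) {i i' : ℕ} (hi : i < q * q) (hi' : i' < q * q) (hne : i ≠ i')
    {s s' : ℕ} (hs : s < q) (hs' : s' < q) (h1 : hub q i s = hub q i' s) (h2 : hub q i s' = hub q i' s') :
    s = s' := by
  haveI := Fact.mk hq
  unfold hub at h1 h2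
  have hqp := hq.pos
  have ha : i / q < q := Nat.div_lt_of_lt_mul hi
  have ha' : i' / q < q := Nat.div_lt_of_lt_mul hi'
  have hb : i % q < q := Nat.mod_lt _ hqp
  have hb' : i' % q < q := Nat.mod_lt _ hqp
  by_contra hss
  have h3 : (((i / q : ℕ) : ZMod q) - ((i' / q : ℕ) : ZMod q)) * ((s : ZMod q) - s') = 0 := by
    linear_combination h1 - h2
  rcases mul_eq_zero.1 h3 with h | h
  · have e := sub_eq_zero.1 h
    have e1 := natCast_inj_lt ha ha' e
    rw [e] at h1
    have e2 := natCast_inj_lt hb hb' (add_left_cancel h1)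
    apply hne
    rw [← Nat.div_add_mod i q, ← Nat.div_add_mod i' q, e1, e2]
  · exact hss (natCast_inj_lt hs hs' (sub_eq_zero.1 h))


abbrev KK (L q : ℕ) := (Fin L × ZMod q) ⊕ ((Fin L × ZMod q) ⊕ Fin q)

inductive gAdj {L : ℕ} (n q : ℕ) (ν : ℕ → Fin L → Equiv.Perm ℤ) : ℤ × KK L q → ℤ × KK L q → Prop
  | ac (I : ℤ) (p : Fin L × ZMod q) (j : Fin q) : gAdj n q ν (I, Sum.inl p) (I, Sum.inr (Sum.inr j))
  | cb (I : ℤ) (p : Fin L × ZMod q) (j : Fin q) : gAdj n q ν (I, Sum.inr (Sum.inr j)) (I, Sum.inr (Sum.inl p))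
  | ba (i : ℕ) (hi : i < n) (s : Fin L) (I : ℤ) :
      gAdj n q ν (I, Sum.inr (Sum.inl (s, hub q i s))) (ν i s I, Sum.inl (s, hub q i s))

def krank {L q : ℕ} : KK L q → ℤ
  | Sum.inl _ => 0
  | Sum.inr (Sum.inr _) => 1
  | Sum.inr (Sum.inl _) => 2

lemma nxt_gt {i : ℕ} {x y : ℤ} (h : y / 2 ^ i = x / 2 ^ i + 1) : x < y := by
  by_contra hc
  push Not at hc
  have : y / 2 ^ i ≤ x / 2 ^ i := Int.ediv_le_ediv (by positivity) hc
  omega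

lemma gAdj_rank {D n q : ℕ} {ν : ℕ → Fin (16 * D) → Equiv.Perm ℤ} (hν : ∀ i, Mix D i 1 (ν i))
    {x y : ℤ × KK (16 * D) q} (h : gAdj n q ν x y) : 3 * x.1 + krank x.2 < 3 * y.1 + krank y.2 := by
  cases h with
  | ac I p j => simp [krank]
  | cb I p j => simp [krank]
  | ba i hi s I =>
    have := nxt_gt ((hν i).1 s I)
    simp only [krank]; omega

lemma gAdj_mono {D n q : ℕ} {ν : ℕ → Fin (16 * D) → Equiv.Perm ℤ} (hν : ∀ i, Mix D i 1 (ν i))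
    {x y : ℤ × KK (16 * D) q} (h : gAdj n q ν x y) : x.1 ≤ y.1 := by
  cases h with
  | ac I p j => simp
  | cb I p j => simp
  | ba i hi s I => exact (nxt_gt ((hν i).1 s I)).le

/-- finite graph -/
def fAdj {L : ℕ} (n q : ℕ) (ν : ℕ → Fin L → Equiv.Perm ℤ) (x y : Fin (2 ^ n) × KK L q) : Prop :=
  gAdj n q ν (((x.1 : ℕ) : ℤ), x.2) (((y.1 : ℕ) : ℤ), y.2)

def kdeg {L q : ℕ} : KK L q → ℕ
  | Sum.inl _ => q
  | Sum.inr (Sum.inr _) => L * q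
  | Sum.inr (Sum.inl _) => q

lemma fcast_inj {m : ℕ} {a b : Fin m} (h : ((a : ℕ) : ℤ) = ((b : ℕ) : ℤ)) : a = b :=
  Fin.ext (by exact_mod_cast h)

lemma fAdj_indeg {L n q : ℕ} (hq : 0 < q) (hn : n ≤ q * q) (ν : ℕ → Fin L → Equiv.Perm ℤ)
    (y : Fin (2 ^ n) × KK L q) : Nat.card {x // fAdj n q ν x y} ≤ kdeg y.2 := by
  have : NeZero q := ⟨hq.ne'⟩
  obtain ⟨I, p | p | j⟩ := y
  · -- A
    have hex : ∀ x : {x // fAdj n q ν x (I, Sum.inl p)}, ∃ i : ℕ, i < n ∧ hub q i p.1 = p.2 ∧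
        x.1.2 = Sum.inr (Sum.inl p) ∧ ν i p.1 ((x.1.1 : ℕ) : ℤ) = ((I : ℕ) : ℤ) := by
      rintro ⟨⟨I', k⟩, hx⟩
      have hx2 : gAdj n q ν (((I' : ℕ) : ℤ), k) (((I : ℕ) : ℤ), (Sum.inl p : KK L q)) := hx
      generalize ha : (((I' : ℕ) : ℤ), k) = a at hx2
      generalize hb : (((I : ℕ) : ℤ), (Sum.inl p : KK L q)) = b at hx2
      cases hx2 with
      | ac => simp at hb
      | cb => simp at hb
      | ba i hi s I0 =>
        simp only [Prod.mk.injEq, Sum.inl.injEq] at ha hb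
        obtain ⟨ha1, ha2⟩ := ha
        obtain ⟨hb1, rfl⟩ := hb
        refine ⟨i, hi, rfl, ha2, ?_⟩
        simp only
        rw [ha1, hb1]
    choose g hg using hex
    have : Nat.card {x // fAdj n q ν x (I, Sum.inl p)} ≤ Nat.card (Fin q) := by
      apply Nat.card_le_card_of_injective
        (fun x => (⟨g x / q, Nat.div_lt_of_lt_mul ((hg x).1.trans_le hn)⟩ : Fin q))
      intro x x' h
      have h := Fin.mk.inj h
      have e1 := (hg x).2.1
      have e2 := (hg x').2.1
      unfold hub at e1 e2
      rw [← h] at e2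
      have e3 := natCast_inj_lt (Nat.mod_lt _ hq) (Nat.mod_lt _ hq) (add_left_cancel (e1.trans e2.symm))
      have e4 : g x = g x' := by rw [← Nat.div_add_mod (g x) q, ← Nat.div_add_mod (g x') q, h, e3]
      have e5 := (hg x).2.2.2.trans (hg x').2.2.2.symm
      rw [e4] at e5
      apply Subtype.ext
      refine Prod.ext (fcast_inj ((ν (g x') p.1).injective e5)) ((hg x).2.2.1.trans (hg x').2.2.1.symm)
    simpa [kdeg] using this
  · -- B
    have : Nat.card {x // fAdj n q ν x (I, Sum.inr (Sum.inl p))} ≤ Nat.card (Fin q) := by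
      apply Nat.card_le_card_of_surjective (fun j => (⟨(I, Sum.inr (Sum.inr j)), gAdj.cb _ _ _⟩ :
        {x // fAdj n q ν x (I, Sum.inr (Sum.inl p))}))
      rintro ⟨⟨I', k⟩, hx⟩
      have hx2 : gAdj n q ν (((I' : ℕ) : ℤ), k) (((I : ℕ) : ℤ), (Sum.inr (Sum.inl p) : KK L q)) := hx
      generalize ha : (((I' : ℕ) : ℤ), k) = a at hx2
      generalize hb : (((I : ℕ) : ℤ), (Sum.inr (Sum.inl p) : KK L q)) = b at hx2
      cases hx2 with
      | ac => simp at hb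
      | cb I0 p0 j0 =>
        simp only [Prod.mk.injEq] at ha hb
        refine ⟨j0, Subtype.ext (Prod.ext (fcast_inj (hb.1.trans ha.1.symm)) ha.2.symm)⟩
      | ba i hi s I0 => simp at hb
    simpa [kdeg] using this
  · have : Nat.card {x // fAdj n q ν x (I, Sum.inr (Sum.inr j))} ≤ Nat.card (Fin L × ZMod q) := by
      apply Nat.card_le_card_of_surjective (fun p => (⟨(I, Sum.inl p), gAdj.ac _ _ _⟩ :
        {x // fAdj n q ν x (I, Sum.inr (Sum.inr j))}))
      rintro ⟨⟨I', k⟩, hx⟩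
      have hx2 : gAdj n q ν (((I' : ℕ) : ℤ), k) (((I : ℕ) : ℤ), (Sum.inr (Sum.inr j) : KK L q)) := hx
      generalize ha : (((I' : ℕ) : ℤ), k) = a at hx2
      generalize hb : (((I : ℕ) : ℤ), (Sum.inr (Sum.inr j) : KK L q)) = b at hx2
      cases hx2 with
      | ac I0 p0 j0 =>
        simp only [Prod.mk.injEq] at ha hb
        refine ⟨p0, Subtype.ext (Prod.ext (fcast_inj (hb.1.trans ha.1.symm)) ha.2.symm)⟩
      | cb I0 p0 j0 => simp at hb
      | ba i hi s I0 => simp at hb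
    simpa [kdeg] using this

lemma sum_kdeg (L n q : ℕ) [NeZero q] : ∑ y : Fin (2 ^ n) × KK L q, kdeg y.2 = 3 * 2 ^ n * L * q ^ 2 := by
  rw [Fintype.sum_prod_type]
  simp only [Fintype.sum_sum_type, kdeg]
  simp [ZMod.card]
  ring

/-- lifting alive walks to the finite graph -/
lemma lift_walk {D n q : ℕ} {ν : ℕ → Fin (16 * D) → Equiv.Perm ℤ} (hν : ∀ i, Mix D i 1 (ν i))
    (al : ℤ × KK (16 * D) q → Prop) {x y : ℤ × KK (16 * D) q}
    (h : Relation.TransGen (fun a b => gAdj n q ν a b ∧ al b) x y)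
    (y' : Fin (2 ^ n) × KK (16 * D) q) (hy : ((((y'.1 : Fin (2 ^ n)) : ℕ) : ℤ), y'.2) = y) :
    ∀ x' : Fin (2 ^ n) × KK (16 * D) q, ((((x'.1 : Fin (2 ^ n)) : ℕ) : ℤ), x'.2) = x → 
    Relation.TransGen (fun a b => fAdj n q ν a b ∧ al (((b.1 : ℕ) : ℤ), b.2)) x' y' := by
  have hmono : ∀ a b, Relation.TransGen (fun a b => gAdj n q ν a b ∧ al b) a b → a.1 ≤ b.1 := by
    intro a b h
    induction h with
    | single h => exact gAdj_mono hν h.1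
    | tail _ h ih => exact ih.trans (gAdj_mono hν h.1)
  induction h using Relation.TransGen.head_induction_on with
  | single h =>
    intro x' hx
    refine Relation.TransGen.single ⟨?_, ?_⟩
    · unfold fAdj; rw [hx, hy]; exact h.1
    · rw [hy]; exact h.2
  | head h1 h2 ih =>
    rename_i a c
    intro x' hx
    have m1 := gAdj_mono hν h1.1
    have m2 := hmono _ _ h2
    have l1 : 0 ≤ c.1 := by
      rw [← hx] at m1; simp only at m1; omega
    have l2 : c.1 < 2 ^ n := by
      have := y'.1.2
      have : ((y'.1 : ℕ) : ℤ) < 2 ^ n := by exact_mod_cast this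
      rw [← hy] at m2; simp only at m2; omega
    obtain ⟨z, hz⟩ := Int.eq_ofNat_of_zero_le l1
    have hz2 : z < 2 ^ n := by rw [hz] at l2; exact_mod_cast l2
    have hc : ((((⟨z, hz2⟩ : Fin (2 ^ n)) : ℕ) : ℤ), c.2) = c := Prod.ext hz.symm rfl
    refine Relation.TransGen.head ?_ (ih (⟨z, hz2⟩, c.2) hc)
    refine ⟨?_, ?_⟩
    · unfold fAdj; rw [hx]; simp only; rw [hc]; exact h1.1
    · simp only; rw [hc]; exact h1.2


lemma cnt_lemma {L : ℕ} (J : Finset ℤ) (X : ℤ → Finset (Fin L)) (g : Fin L → ℤ → ℤ)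
    (F : Finset (Fin L × ℤ)) (h : ∀ p ∈ F, ∃ I ∈ J, p.1 ∈ X I ∧ p.2 = g p.1 I) :
    F.card ≤ ∑ I ∈ J, (X I).card := by
  classical
  have : F ⊆ J.biUnion (fun I => (X I).image (fun s => (s, g s I))) := by
    intro p hp
    obtain ⟨I, hI, h1, h2⟩ := h p hp
    refine Finset.mem_biUnion.2 ⟨I, hI, Finset.mem_image.2 ⟨p.1, h1, ?_⟩⟩
    rw [← h2]
  refine (Finset.card_le_card this).trans (Finset.card_biUnion_le.trans ?_)
  exact Finset.sum_le_sum (fun I _ => Finset.card_image_le)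

open Classical in
noncomputable def XA {L q : ℕ} [NeZero q] (S : Finset (ℤ × KK L q)) (I : ℤ) : Finset (Fin L × ZMod q) :=
  Finset.univ.filter (fun p => (I, Sum.inl p) ∈ S)
open Classical in
noncomputable def XB {L q : ℕ} [NeZero q] (S : Finset (ℤ × KK L q)) (I : ℤ) : Finset (Fin L × ZMod q) :=
  Finset.univ.filter (fun p => (I, Sum.inr (Sum.inl p)) ∈ S)
open Classical in
noncomputable def XC {L q : ℕ} (S : Finset (ℤ × KK L q)) (I : ℤ) : Finset (Fin q) :=
  Finset.univ.filter (fun p => (I, Sum.inr (Sum.inr p)) ∈ S)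

lemma X_sum {L q : ℕ} [NeZero q] (S : Finset (ℤ × KK L q)) (F : Finset ℤ) :
    ∑ I ∈ F, ((XA S I).card + ((XB S I).card + (XC S I).card)) ≤ S.card := by
  classical
  have h1 : ∀ I ∈ F, (XA S I).card + ((XB S I).card + (XC S I).card) ≤ (S.filter (fun x => x.1 = I)).card := by
    intro I _
    have : ((XA S I).disjSum ((XB S I).disjSum (XC S I))).card ≤ (S.filter (fun x => x.1 = I)).card := by
      apply Finset.card_le_card_of_injOn (fun k => (I, k))
      · intro k hk
        have hk : k ∈ (XA S I).disjSum ((XB S I).disjSum (XC S I)) := hk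
        simp only [Finset.coe_filter, Set.mem_ofPred_eq, and_true]
        rcases k with p | p | j <;> simpa [XA, XB, XC] using hk
      · intro a _ b _ h
        exact (Prod.mk.inj h).2
    simpa [Finset.card_disjSum] using this
  refine (Finset.sum_le_sum h1).trans ?_
  rw [← Finset.card_biUnion]
  · apply Finset.card_le_card
    intro x hx
    obtain ⟨I, _, hx⟩ := Finset.mem_biUnion.1 hx
    exact (Finset.mem_filter.1 hx).1
  · intro a _ b _ hab
    rw [Function.onFun, Finset.disjoint_left]
    intro x hx hx'
    exact hab ((Finset.mem_filter.1 hx).2.symm.trans (Finset.mem_filter.1 hx').2)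

open Classical in
noncomputable def bet {L q : ℕ} (X : Finset (Fin L × ZMod q)) (i : ℕ) : Finset (Fin L) :=
  Finset.univ.filter (fun s => (s, hub q i s) ∈ X)

open Classical in
noncomputable def hv {L q : ℕ} (ω : ℕ) (X : Finset (Fin L × ZMod q)) (i : ℕ) : Finset (Fin L) :=
  if ω ≤ (bet X i).card then bet X i else ∅

lemma hv_sum {L q : ℕ} (hq : q.Prime) {n ω : ℕ} (hn : n ≤ q * q) (hL : L ≤ q)
    (X : Finset (Fin L × ZMod q)) (hX : 2 * X.card < ω * ω) :
    ∑ i ∈ Finset.range n, (hv ω X i).card ≤ 2 * X.card := by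
  classical
  have := rs_lemma n ω (fun i (s : Fin L) => hub q i s) (by
    intro i hi i' hi' hne s s' h1 h2
    exact Fin.ext (hub_sep hq (hi.trans_le hn) (hi'.trans_le hn) hne (s.2.trans_le hL) (s'.2.trans_le hL) h1 h2)) X hX
  rw [Finset.sum_filter] at this
  have this2 : ∑ i ∈ Finset.range n, (if ω ≤ (bet X i).card then (bet X i).card else 0) ≤ 2 * X.card := by
    unfold bet; convert this
  refine le_trans (le_of_eq ?_) this2
  apply Finset.sum_congr rfl
  intro i _
  unfold hv
  split_ifs <;> simp

def deadC {L q : ℕ} [NeZero q] (ω : ℕ) (S : Finset (ℤ × KK L q)) (I : ℤ) : Prop :=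
  ω * ω ≤ 2 * (XA S I).card ∨ ω * ω ≤ 2 * (XB S I).card ∨ q ≤ (XC S I).card

def alC {L q : ℕ} (S : Finset (ℤ × KK L q)) (I : ℤ) (j : Fin q) : Prop :=
  (I, (Sum.inr (Sum.inr j) : KK L q)) ∉ S

def RC {L : ℕ} (n q : ℕ) (ν : ℕ → Fin L → Equiv.Perm ℤ) (S : Finset (ℤ × KK L q)) (I I' : ℤ) : Prop :=
  ∀ j j', alC S I j → alC S I' j' →
    Relation.TransGen (fun a b => gAdj n q ν a b ∧ b ∉ S) (I, Sum.inr (Sum.inr j)) (I', Sum.inr (Sum.inr j'))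

lemma exists_al {L q : ℕ} [NeZero q] {ω : ℕ} {S : Finset (ℤ × KK L q)} {I : ℤ} (h : ¬ deadC ω S I) :
    ∃ j, alC S I j := by
  by_contra hc
  unfold alC at hc
  push Not at hc
  apply h
  refine Or.inr (Or.inr ?_)
  have : XC S I = Finset.univ := by
    ext j; simp [XC, hc j]
  rw [this]; simp

lemma core {D n q ω t e d μ : ℕ} (hq : q.Prime) (hn : n ≤ q * q) (hL : 16 * D ≤ q) (hω : 1 ≤ ω)
    (hD : 4 * ω * 2 ^ (t + 2) ≤ D) (hμ1 : μ ≤ ω * ω) (hμ2 : μ ≤ 2 * q) (hμ : 0 < μ)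
    (h1 : 544 * (2 * e) ≤ (t + 1) * D * 2 ^ n) (h2 : 8704 * e ≤ μ * 2 ^ n)
    (hw : 8 * (3 * n + 1) ^ t * (d + 1) ≤ 2 ^ n)
    {ν : ℕ → Fin (16 * D) → Equiv.Perm ℤ} (hν : ∀ i, Mix D i 1 (ν i))
    (hν' : ∀ i, Mix D i (-1) (fun s => (ν i s).symm))
    (S : Finset (ℤ × KK (16 * D) q)) (hS : S.card ≤ e) :
    ∃ W ⊆ Finset.Ico (0 : ℤ) (2 ^ n), d + 1 ≤ W.card ∧ (∀ u ∈ W, ∃ j, alC S u j) ∧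
      ∀ u ∈ W, ∀ v ∈ W, u < v → RC n q ν S u v := by
  classical
  have : NeZero q := ⟨hq.pos.ne'⟩
  obtain ⟨P, hP⟩ : ∃ P : ℕ → Fin (16 * D) → ℤ → Prop, ∀ i s I, P i s I ↔
      (s ∈ bet (XB S I) i ∧ (bet (XB S I) i).card < ω) := ⟨_, fun _ _ _ => Iff.rfl⟩
  obtain ⟨Q, hQ⟩ : ∃ Q : ℕ → Fin (16 * D) → ℤ → Prop, ∀ i s I, Q i s I ↔
      (s ∈ bet (XA S I) i ∧ (bet (XA S I) i).card < ω) := ⟨_, fun _ _ _ => Iff.rfl⟩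
  set Ch : ℕ → Fin (16 * D) → ℤ → Prop := fun i s I =>
    (¬ deadC ω S I ∧ s ∈ hv ω (XB S I) i) ∨ (¬ deadC ω S (ν i s I) ∧ s ∈ hv ω (XA S (ν i s I)) i) with hCh
  set R : ℤ → ℤ → Prop := fun I I' => (∃ j, alC S I j) ∧ (∃ j, alC S I' j) ∧ RC n q ν S I I' with hR
  have hvmem : ∀ (X : Finset (Fin (16 * D) × ZMod q)) i s, s ∈ hv ω X i ↔ s ∈ bet X i ∧ ω ≤ (bet X i).card := by
    intro X i s
    unfold hv
    split_ifs with h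
    · simp [h]
    · simp [h]
  have hsys : Sys D n ω 1 ν (deadC ω S) R Ch P Q := by
    refine ⟨hν, ?_, ?_, ?_, ?_⟩
    · rintro x y z ⟨a1, ⟨j, hj⟩, a3⟩ ⟨b1, b2, b3⟩
      exact ⟨a1, b2, fun k k' hk hk' => (a3 k j hk hj).trans (b3 j k' hj hk')⟩
    · intro i hi s x hx hx'
      by_cases hB : s ∈ bet (XB S x) i
      · by_cases hl : (bet (XB S x) i).card < ω
        · exact Or.inr (Or.inr (Or.inl ((hP _ _ _).2 ⟨hB, hl⟩)))
        · exact Or.inr (Or.inl (Or.inl ⟨hx, (hvmem _ _ _).2 ⟨hB, by omega⟩⟩))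
      by_cases hA : s ∈ bet (XA S (ν i s x)) i
      · by_cases hl : (bet (XA S (ν i s x)) i).card < ω
        · exact Or.inr (Or.inr (Or.inr ((hQ _ _ _).2 ⟨hA, hl⟩)))
        · exact Or.inr (Or.inl (Or.inr ⟨hx', (hvmem _ _ _).2 ⟨hA, by omega⟩⟩))
      left
      refine ⟨exists_al hx, exists_al hx', ?_⟩
      intro j j' hj hj'
      have hB' : (x, (Sum.inr (Sum.inl (s, hub q i s)) : KK (16 * D) q)) ∉ S := by
        simpa [bet, XB] using hB
      have hA' : (ν i s x, (Sum.inl (s, hub q i s) : KK (16 * D) q)) ∉ S := by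
        simpa [bet, XA] using hA
      exact ((Relation.TransGen.single ⟨gAdj.cb x (s, hub q i s) j, hB'⟩).tail
        ⟨gAdj.ba i hi s x, hA'⟩).tail ⟨gAdj.ac _ _ j', hj'⟩
    · intro i _ x _
      by_cases hl : (bet (XB S x) i).card < ω
      · refine (Finset.card_le_card ?_).trans hl.le
        intro s hs
        rw [Finset.mem_filter, hP] at hs
        exact hs.2.1
      · refine (Finset.card_le_card (t := ∅) ?_).trans (by simp)
        intro s hs
        rw [Finset.mem_filter, hP] at hs
        exact absurd hs.2.2 hl
    · intro i _ x _
      by_cases hl : (bet (XA S x) i).card < ω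
      · refine (Finset.card_le_card ?_).trans hl.le
        intro s hs
        rw [Finset.mem_filter, hQ] at hs
        exact hs.2.1
      · refine (Finset.card_le_card (t := ∅) ?_).trans (by simp)
        intro s hs
        rw [Finset.mem_filter, hQ] at hs
        exact absurd hs.2.2 hl
  set J := (S.image Prod.fst).filter (fun I => ¬ deadC ω S I) with hJ
  have memJ : ∀ I, ¬ deadC ω S I → ∀ k, (I, k) ∈ S → I ∈ J := by
    intro I hI k hk
    exact Finset.mem_filter.2 ⟨Finset.mem_image.2 ⟨_, hk, rfl⟩, hI⟩
  have hE : ∀ i < n, ∀ F : Finset (Fin (16 * D) × ℤ), (∀ p ∈ F, Ch i p.1 p.2) →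
      F.card ≤ ∑ I ∈ J, (hv ω (XB S I) i).card + ∑ I ∈ J, (hv ω (XA S I) i).card := by
    intro i _ F hF
    rw [← Finset.card_filter_add_card_filter_not (s := F)
      (fun p => ¬ deadC ω S p.2 ∧ p.1 ∈ hv ω (XB S p.2) i)]
    apply add_le_add
    · apply cnt_lemma J (fun I => hv ω (XB S I) i) (fun s I => I)
      intro p hp
      obtain ⟨_, hp1, hp2⟩ := Finset.mem_filter.1 hp
      refine ⟨p.2, memJ _ hp1 (Sum.inr (Sum.inl (p.1, hub q i p.1))) ?_, hp2, rfl⟩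
      have := ((hvmem _ _ _).1 hp2).1
      simpa [bet, XB] using this
    · apply cnt_lemma J (fun I => hv ω (XA S I) i) (fun s I => (ν i s).symm I)
      intro p hp
      obtain ⟨hp0, hp1⟩ := Finset.mem_filter.1 hp
      rcases hF p hp0 with h | ⟨h1, h2⟩
      · exact absurd h hp1
      refine ⟨ν i p.1 p.2, memJ _ h1 (Sum.inl (p.1, hub q i p.1)) ?_, h2, by simp⟩
      have := ((hvmem _ _ _).1 h2).1
      simpa [bet, XA] using this
  have hEt : ∑ i ∈ Finset.range n, (∑ I ∈ J, (hv ω (XB S I) i).card + ∑ I ∈ J, (hv ω (XA S I) i).card) ≤ 2 * e := by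
    rw [Finset.sum_add_distrib, Finset.sum_comm, Finset.sum_comm (s := Finset.range n), ← Finset.sum_add_distrib]
    have hs := X_sum S J
    calc _ ≤ ∑ I ∈ J, 2 * ((XA S I).card + ((XB S I).card + (XC S I).card)) := by
          apply Finset.sum_le_sum
          intro I hI
          have hd := (Finset.mem_filter.1 hI).2
          unfold deadC at hd
          push Not at hd
          have a1 := hv_sum (ω := ω) hq hn hL (XB S I) hd.2.1
          have a2 := hv_sum (ω := ω) hq hn hL (XA S I) hd.1
          omega
      _ = 2 * ∑ I ∈ J, ((XA S I).card + ((XB S I).card + (XC S I).card)) := by rw [Finset.mul_sum]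
      _ ≤ 2 * e := by omega
  have hdd : ∀ F : Finset ℤ, (∀ x ∈ F, deadC ω S x) → F.card ≤ 2 * e / μ := by
    intro F hF
    rw [Nat.le_div_iff_mul_le hμ]
    have hs := X_sum S F
    have : F.card * μ ≤ ∑ I ∈ F, 2 * ((XA S I).card + ((XB S I).card + (XC S I).card)) := by
      have := Finset.card_nsmul_le_sum F (fun I => 2 * ((XA S I).card + ((XB S I).card + (XC S I).card))) μ (by
        intro I hI
        rcases hF I hI with h | h | h <;> omega)
      simpa using this
    rw [← Finset.mul_sum] at this
    omega
  have h2' : 4352 * (2 * e / μ) ≤ 2 ^ n := by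
    have a := Nat.div_mul_le_self (2 * e) μ
    have : 4352 * (2 * e / μ) * μ ≤ 2 ^ n * μ := by
      calc 4352 * (2 * e / μ) * μ = 4352 * (2 * e / μ * μ) := by ring
        _ ≤ 4352 * (2 * e) := by gcongr
        _ ≤ _ := by linarith
    exact Nat.le_of_mul_le_mul_right this hμ
  obtain ⟨W, hW, hWc, hWd, hWR⟩ := cluster_thm hsys hν' hω hD _ hE hEt hdd h1 h2' hw
  exact ⟨W, hW, hWc, fun u hu => exists_al (hWd u hu), fun u hu v hv huv => (hWR u hu v hv huv).2.2⟩

lemma graph_thm {D n q ω t e d μ : ℕ} (hq : q.Prime) (hn : n ≤ q * q) (hD0 : 1 ≤ D) (hL : 16 * D ≤ q) (hω : 1 ≤ ω)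
    (hD : 4 * ω * 2 ^ (t + 2) ≤ D) (hμ1 : μ ≤ ω * ω) (hμ2 : μ ≤ 2 * q) (hμ : 0 < μ)
    (h1 : 544 * (2 * e) ≤ (t + 1) * D * 2 ^ n) (h2 : 8704 * e ≤ μ * 2 ^ n)
    (hw : 8 * (3 * n + 1) ^ t * (d + 1) ≤ 2 ^ n) :
    ∃ G : Dig, Acyclic G.Adj ∧ Nat.card G.V = 3 * 2 ^ n * (16 * D) * q ^ 2 ∧
      (∀ x, indeg G.Adj x ≤ 2) ∧ DepthRobust G.Adj e d := by
  classical
  have : NeZero q := ⟨hq.pos.ne'⟩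
  choose ν hν hν' using fun i => exists_nxt D i
  have hred := reduction (V := Fin (2 ^ n) × KK (16 * D) q) (fAdj n q ν) (fun x => kdeg x.2)
    (fun x => 3 * ((x.1 : ℕ) : ℤ) + krank x.2) (fun u v h => gAdj_rank hν h)
    (by
      rintro ⟨I, p | p | j⟩ <;> simp only [kdeg]
      · exact hq.pos
      · exact hq.pos
      · exact Nat.mul_pos (by omega) hq.pos)
    (fun v => fAdj_indeg hq.pos hn ν v) e d ?_
  · obtain ⟨G, g1, g2, g3, g4⟩ := hred
    exact ⟨G, g1, g2.trans (sum_kdeg _ _ _), g3, g4⟩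
  intro S hS
  set φ : Fin (2 ^ n) × KK (16 * D) q → ℤ × KK (16 * D) q := fun x => (((x.1 : ℕ) : ℤ), x.2) with hφ
  have hinj : Function.Injective φ := by
    intro a b h
    have := Prod.mk.inj h
    exact Prod.ext (fcast_inj this.1) this.2
  obtain ⟨W, hW, hWc, hWa, hWR⟩ := core hq hn hL hω hD hμ1 hμ2 hμ h1 h2 hw hν hν' (S.image φ)
    (Finset.card_image_le.trans hS)
  choose! c hc using hWa
  have hz : ∀ u ∈ W, ∃ z : Fin (2 ^ n), ((z : ℕ) : ℤ) = u := by
    intro u hu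
    obtain ⟨a, b⟩ := Finset.mem_Ico.1 (hW hu)
    obtain ⟨z, rfl⟩ := Int.eq_ofNat_of_zero_le a
    exact ⟨⟨z, by exact_mod_cast b⟩, rfl⟩
  have : Nonempty (Fin (2 ^ n)) := ⟨⟨0, by positivity⟩⟩
  choose! z hz using hz
  have hmem : ∀ x, φ x ∉ S.image φ ↔ x ∉ S := by
    intro x
    rw [Finset.mem_image]
    constructor
    · intro h hx; exact h ⟨x, hx, rfl⟩
    · rintro h ⟨y, hy, hxy⟩; exact h (hinj hxy ▸ hy)
  have hφu : ∀ u ∈ W, φ (z u, Sum.inr (Sum.inr (c u))) = (u, Sum.inr (Sum.inr (c u))) := by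
    intro u hu
    simp only [hφ, hz u hu]
  obtain ⟨v, _, hv⟩ := reach_chain (Adj := fAdj n q ν) (al := fun x => x ∉ S)
    (fun u => ((z u, Sum.inr (Sum.inr (c u))) : Fin (2 ^ n) × KK (16 * D) q)) W
    (by
      intro u hu
      rw [← hmem, hφu u hu]
      exact hc u hu)
    (by
      intro u hu v hv huv
      have := lift_walk hν (fun b => b ∉ S.image φ) (hWR u hu v hv huv _ _ (hc u hu) (hc v hv))
        (z v, Sum.inr (Sum.inr (c v))) (hφu v hv) (z u, Sum.inr (Sum.inr (c u))) (hφu u hu)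
      refine Relation.TransGen.mono ?_ _ _ this
      intro a b hab
      exact ⟨hab.1, (hmem b).1 hab.2⟩) d hWc
  exact ⟨_, hv⟩


lemma pow_aux (a : ℕ) (ha : 6 ≤ a) : 8 * a + 8 ≤ 2 ^ a := by
  induction a, ha using Nat.le_induction with
  | base => norm_num
  | succ n hn ih => rw [pow_succ]; omega

lemma K_aux {K : ℕ} (hK : 200 ≤ K) : K ≤ 2 ^ (K / 8) := by
  have := pow_aux (K / 8) (by omega)
  omega

lemma K_sq {K ℓ : ℕ} (hK : 200 ≤ K) (h1 : 2 ^ K ≤ ℓ) : K + K * K ≤ ℓ := by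
  have h := K_aux hK
  calc K + K * K ≤ K * K * K := by nlinarith [Nat.mul_le_mul hK hK]
    _ ≤ 2 ^ (K / 8) * 2 ^ (K / 8) * 2 ^ (K / 8) := by gcongr
    _ = 2 ^ (K / 8 + K / 8 + K / 8) := by rw [pow_add, pow_add]
    _ ≤ 2 ^ K := Nat.pow_le_pow_right (by norm_num) (by omega)
    _ ≤ ℓ := h1

lemma param {K ℓ e d : ℕ} (hK : 200 ≤ K) (h1 : 2 ^ K ≤ ℓ) (h2 : ℓ < 2 ^ (K + 1))
    (he : 1740800 * e ≤ K * 2 ^ (ℓ - K)) (hd : d ≤ 2 ^ (ℓ - K - K * K)) :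
    ∃ G : Dig, Acyclic G.Adj ∧ Nat.card G.V ≤ 48 * 2 ^ ℓ ∧ (∀ x, indeg G.Adj x ≤ 2) ∧
      DepthRobust G.Adj e d := by
  have hsq := K_sq hK h1
  have hKa := K_aux hK
  have hKK : 200 * K ≤ K * K := Nat.mul_le_mul_right _ hK
  obtain ⟨q, hq, hq1, hq2⟩ := Nat.exists_prime_lt_and_le_two_mul (2 ^ ((K + 2) / 2)) (by positivity)
  set h := (K + 2) / 2 with hh
  set δ := K / 4 with hδ
  set t := K / 100 with ht
  obtain ⟨r, hr⟩ : ∃ r, δ = r + t + 8 := ⟨δ - t - 8, by omega⟩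
  obtain ⟨n, hn⟩ : ∃ n, ℓ = n + K + δ := ⟨ℓ - K - δ, by omega⟩
  have hnq : n ≤ q * q := by
    calc n ≤ 2 ^ (K + 1) := by omega
      _ ≤ 2 ^ (h + h) := Nat.pow_le_pow_right (by norm_num) (by omega)
      _ = 2 ^ h * 2 ^ h := pow_add _ _ _
      _ ≤ q * q := by gcongr
  have hD16 : 16 * 2 ^ (r + t + 4) = 2 ^ δ := by
    rw [hr, show r + t + 8 = (r + t + 4) + 4 by ring, pow_add 2 (r + t + 4) 4]; ring
  have hℓK : ℓ - K = n + δ := by omega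
  obtain ⟨G, g1, g2, g3, g4⟩ := graph_thm (D := 2 ^ (r + t + 4)) (n := n) (q := q) (ω := 2 ^ r) (t := t)
    (e := e) (d := d) (μ := 2 ^ r * 2 ^ r) hq hnq Nat.one_le_two_pow
    (by
      rw [hD16]
      exact (Nat.pow_le_pow_right (by norm_num) (by omega)).trans hq1.le)
    Nat.one_le_two_pow
    (by
      apply le_of_eq
      rw [show r + t + 4 = r + (t + 2) + 2 by ring, pow_add 2 (r + (t + 2)) 2, pow_add 2 r]; ring)
    le_rfl
    (by
      rw [← pow_add]
      have : 2 ^ (r + r) ≤ 2 ^ h := Nat.pow_le_pow_right (by norm_num) (by omega)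
      omega)
    (by positivity)
    (by
      rw [hℓK, pow_add, ← hD16] at he
      have hKt : K ≤ 100 * (t + 1) := by omega
      have : K * (2 ^ n * (16 * 2 ^ (r + t + 4))) ≤ 100 * (t + 1) * (2 ^ n * (16 * 2 ^ (r + t + 4))) :=
        Nat.mul_le_mul_right _ hKt
      have e1 : 100 * (t + 1) * (2 ^ n * (16 * 2 ^ (r + t + 4))) = 1600 * ((t + 1) * 2 ^ (r + t + 4) * 2 ^ n) := by ring
      omega)
    (by
      rw [hℓK] at he
      have : K * 2 ^ (n + δ) ≤ 2 ^ (r + r) * 2 ^ n := by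
        calc K * 2 ^ (n + δ) ≤ 2 ^ (K / 8) * 2 ^ (n + δ) := by gcongr
          _ = 2 ^ (K / 8 + (n + δ)) := by rw [← pow_add]
          _ ≤ 2 ^ (r + r + n) := Nat.pow_le_pow_right (by norm_num) (by omega)
          _ = _ := by rw [pow_add 2 (r + r) n]
      rw [← pow_add]
      omega)
    (by
      have a1 : 3 * n + 1 ≤ 2 ^ (K + 3) := by
        have : 2 ^ (K + 3) = 4 * 2 ^ (K + 1) := by rw [show K + 3 = K + 1 + 2 by ring, pow_add 2 (K + 1)]; ring
        omega
      have a2 : d + 1 ≤ 2 ^ (ℓ - K - K * K + 1) := by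
        have : 1 ≤ 2 ^ (ℓ - K - K * K) := Nat.one_le_two_pow
        rw [pow_succ]; omega
      have a3 : 4 + (K + 3) * t + δ ≤ K * K := by
        have : 100 * ((K + 3) * t) ≤ (K + 3) * K := by
          calc 100 * ((K + 3) * t) = (K + 3) * (100 * t) := by ring
            _ ≤ (K + 3) * K := Nat.mul_le_mul_left _ (by omega)
        have e : (K + 3) * K = K * K + 3 * K := by ring
        omega
      calc 8 * (3 * n + 1) ^ t * (d + 1) ≤ 2 ^ 3 * (2 ^ (K + 3)) ^ t * 2 ^ (ℓ - K - K * K + 1) := by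
            gcongr
            norm_num
        _ = 2 ^ (3 + (K + 3) * t + (ℓ - K - K * K + 1)) := by rw [← pow_mul, ← pow_add, ← pow_add]
        _ ≤ 2 ^ n := Nat.pow_le_pow_right (by norm_num) (by omega))
  refine ⟨G, g1, ?_, g3, g4⟩
  rw [g2, hD16]
  calc 3 * 2 ^ n * 2 ^ δ * q ^ 2 ≤ 3 * 2 ^ n * 2 ^ δ * (2 * 2 ^ h) ^ 2 := by gcongr
    _ = 12 * 2 ^ (n + δ + (h + h)) := by rw [pow_add 2 (n + δ), pow_add, pow_add]; ring
    _ ≤ 12 * 2 ^ (ℓ + 2) := by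
        exact Nat.mul_le_mul_left _ (Nat.pow_le_pow_right (by norm_num) (by omega))
    _ = 48 * 2 ^ ℓ := by rw [pow_add]; ring

lemma log_large (m : ℕ) : ∃ N0 : ℕ, 1 ≤ N0 ∧ ∀ N ≥ N0, m ≤ Nat.log 2 (Nat.log 2 N) := by
  refine ⟨2 ^ 2 ^ m, Nat.one_le_two_pow, fun N hN => ?_⟩
  have h1 : 2 ^ m ≤ Nat.log 2 N := Nat.le_log_of_pow_le (by norm_num) hN
  exact Nat.le_log_of_pow_le (by norm_num) h1

lemma trivial_graph : ∃ G : Dig, Acyclic G.Adj ∧ Nat.card G.V = 1 ∧ (∀ x, indeg G.Adj x ≤ 2) ∧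
    DepthRobust G.Adj 0 0 := by
  refine ⟨⟨Unit, fun _ _ => False⟩, ?_, ?_, ?_, ?_⟩
  · intro v h
    obtain ⟨_, h, _⟩ := Relation.TransGen.head'_iff.1 h
    exact h
  · simp
  · intro x
    simp [indeg]
  · intro S hS
    have : S = ∅ := Finset.card_eq_zero.1 (Nat.le_zero.1 hS)
    subst this
    refine ⟨[()], ⟨by simp, List.isChain_singleton _⟩, by simp, by simp⟩

lemma final_aux : ∃ N0 : ℕ, 1 ≤ N0 ∧ ∀ N : ℕ, 4 ≤ N → ∃ G : Dig, Acyclic G.Adj ∧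
    ((Nat.card G.V : ℝ) ≤ 48 * N) ∧ (∀ x, indeg G.Adj x ≤ 2) ∧
    DepthRobust G.Adj
          ⌊(1 / (10 ^ 7 * N0) : ℝ) * N * Real.logb 2 (Real.logb 2 N) / Real.logb 2 N⌋₊
          ⌊(1 / (2 * N0) : ℝ) * N / Real.logb 2 N ^ ((1 : ℝ) + Real.logb 2 (Real.logb 2 N))⌋₊ := by
  obtain ⟨N0, hN0, hlarge⟩ := log_large 200
  refine ⟨N0, hN0, fun N hN => ?_⟩
  have hN0' : (1 : ℝ) ≤ N0 := by exact_mod_cast hN0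
  have hNpos : (4 : ℝ) ≤ N := by exact_mod_cast hN
  set x := Real.logb 2 N with hx
  set y := Real.logb 2 x with hy
  have hx2 : 2 ≤ x := by
    rw [hx, Real.le_logb_iff_rpow_le (by norm_num) (by linarith)]
    norm_num; exact hN
  have hy1 : 1 ≤ y := by
    rw [hy, Real.le_logb_iff_rpow_le (by norm_num) (by linarith)]
    norm_num; exact hx2
  have hyx : y ≤ x := by
    rw [hy, Real.logb_le_iff_le_rpow (by norm_num) (by linarith)]
    have h := one_add_mul_self_le_rpow_one_add (s := 1) (by norm_num) (p := x) (by linarith)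
    norm_num at h
    linarith
  by_cases hc : N0 ≤ N
  · have hK := hlarge N hc
    set ℓ := Nat.log 2 N with hℓ
    set K := Nat.log 2 ℓ with hKdef
    have hℓ0 : ℓ ≠ 0 := by
      intro h0; rw [h0] at hKdef; simp at hKdef; omega
    have n1 : 2 ^ ℓ ≤ N := Nat.pow_log_le_self 2 (by omega)
    have n2 : N < 2 ^ (ℓ + 1) := Nat.lt_pow_succ_log_self (by norm_num) N
    have l1 : 2 ^ K ≤ ℓ := Nat.pow_log_le_self 2 hℓ0
    have l2 : ℓ < 2 ^ (K + 1) := Nat.lt_pow_succ_log_self (by norm_num) ℓ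
    have hsq := K_sq hK l1
    have n2' : (N : ℝ) ≤ 2 ^ (ℓ + 1) := by exact_mod_cast n2.le
    have hxℓ : (ℓ : ℝ) ≤ x := by
      rw [hx, Real.le_logb_iff_rpow_le (by norm_num) (by linarith), Real.rpow_natCast]
      exact_mod_cast n1
    have hxℓ2 : x ≤ ℓ + 1 := by
      rw [hx, Real.logb_le_iff_le_rpow (by norm_num) (by linarith)]
      have : ((ℓ : ℝ) + 1) = ((ℓ + 1 : ℕ) : ℝ) := by push_cast; ring
      rw [this, Real.rpow_natCast]; exact n2'
    have hxK : (2 : ℝ) ^ K ≤ x := le_trans (by exact_mod_cast l1) hxℓ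
    have hyK : (K : ℝ) ≤ y := by
      rw [hy, Real.le_logb_iff_rpow_le (by norm_num) (by linarith), Real.rpow_natCast]
      exact hxK
    have hyK2 : y ≤ K + 1 := by
      rw [hy, Real.logb_le_iff_le_rpow (by norm_num) (by linarith)]
      have : ((K : ℝ) + 1) = ((K + 1 : ℕ) : ℝ) := by push_cast; ring
      rw [this, Real.rpow_natCast]
      refine hxℓ2.trans ?_
      exact_mod_cast l2
    have hKr : (200 : ℝ) ≤ K := by exact_mod_cast hK
    have hpow1 : (2 : ℝ) ^ ℓ = 2 ^ (ℓ - K) * 2 ^ K := by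
      rw [← pow_add]; congr 1; omega
    have hpow2 : (2 : ℝ) ^ ℓ = 2 ^ (ℓ - K - K * K) * 2 ^ (K * (1 + K)) := by
      rw [← pow_add]; congr 1; rw [show K * (1 + K) = K + K * K by ring]; omega
    have he : 1740800 * ⌊(1 / (10 ^ 7 * N0) : ℝ) * N * y / x⌋₊ ≤ K * 2 ^ (ℓ - K) := by
      have h0 : 0 ≤ (1 / (10 ^ 7 * N0) : ℝ) * N * y / x := by positivity
      have h1 := Nat.floor_le h0
      have h2 : (1 / (10 ^ 7 * N0) : ℝ) * N * y / x ≤ 4 / 10 ^ 7 * (K * 2 ^ (ℓ - K)) := by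
        rw [div_le_iff₀ (by linarith)]
        calc (1 / (10 ^ 7 * N0) : ℝ) * N * y ≤ (1 / (10 ^ 7 * 1) : ℝ) * 2 ^ (ℓ + 1) * (2 * K) := by
              gcongr
              linarith
          _ = 4 / 10 ^ 7 * (K * 2 ^ (ℓ - K)) * 2 ^ K := by
              rw [pow_succ (2 : ℝ) ℓ, hpow1]; ring
          _ ≤ _ := by gcongr
      have h3 : (1740800 * ⌊(1 / (10 ^ 7 * N0) : ℝ) * N * y / x⌋₊ : ℝ) ≤ K * 2 ^ (ℓ - K) := by
        have : (0 : ℝ) ≤ K * 2 ^ (ℓ - K) := by positivity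
        linarith
      exact_mod_cast h3
    have hd : ⌊(1 / (2 * N0) : ℝ) * N / x ^ ((1 : ℝ) + y)⌋₊ ≤ 2 ^ (ℓ - K - K * K) := by
      apply Nat.floor_le_of_le
      have hxp : (2 : ℝ) ^ (K * (1 + K)) ≤ x ^ ((1 : ℝ) + y) := by
        calc (2 : ℝ) ^ (K * (1 + K)) = ((2 : ℝ) ^ K) ^ (((1 + K : ℕ) : ℝ)) := by
              rw [Real.rpow_natCast, pow_mul]
          _ ≤ x ^ (((1 + K : ℕ) : ℝ)) := by gcongr
          _ ≤ x ^ ((1 : ℝ) + y) := by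
              apply Real.rpow_le_rpow_of_exponent_le (by linarith)
              push_cast; linarith
      have hpos : (0 : ℝ) < x ^ ((1 : ℝ) + y) := Real.rpow_pos_of_pos (by linarith) _
      rw [div_le_iff₀ hpos]
      push_cast
      calc (1 / (2 * N0) : ℝ) * N ≤ (1 / (2 * 1) : ℝ) * 2 ^ (ℓ + 1) := by gcongr
        _ = 2 ^ (ℓ - K - K * K) * 2 ^ (K * (1 + K)) := by rw [← hpow2, pow_succ]; ring
        _ ≤ _ := by gcongr
    obtain ⟨G, g1, g2, g3, g4⟩ := param hK l1 l2 he hd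
    refine ⟨G, g1, ?_, g3, g4⟩
    calc (Nat.card G.V : ℝ) ≤ ((48 * 2 ^ ℓ : ℕ) : ℝ) := by exact_mod_cast g2
      _ ≤ ((48 * N : ℕ) : ℝ) := by exact_mod_cast Nat.mul_le_mul_left _ n1
      _ = _ := by push_cast; ring
  · push Not at hc
    have hc' : (N : ℝ) < N0 := by exact_mod_cast hc
    have hNN : (N : ℝ) / N0 < 1 := by rw [div_lt_one (by linarith)]; exact hc'
    have hNN0 : 0 ≤ (N : ℝ) / N0 := by positivity
    have he : ⌊(1 / (10 ^ 7 * N0) : ℝ) * N * y / x⌋₊ = 0 := by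
      rw [Nat.floor_eq_zero]
      have h1 : y / x ≤ 1 := by rw [div_le_one (by linarith)]; exact hyx
      have h2 : 0 ≤ y / x := by positivity
      calc (1 / (10 ^ 7 * N0) : ℝ) * N * y / x = 1 / 10 ^ 7 * (N / N0) * (y / x) := by field_simp
        _ ≤ 1 / 10 ^ 7 * (N / N0) * 1 := by gcongr
        _ < 1 := by linarith
    have hd : ⌊(1 / (2 * N0) : ℝ) * N / x ^ ((1 : ℝ) + y)⌋₊ = 0 := by
      rw [Nat.floor_eq_zero]
      have hpos : (1 : ℝ) ≤ x ^ ((1 : ℝ) + y) := Real.one_le_rpow (by linarith) (by linarith)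
      calc (1 / (2 * N0) : ℝ) * N / x ^ ((1 : ℝ) + y) ≤ (1 / (2 * N0) : ℝ) * N := div_le_self (by positivity) hpos
        _ = 1 / 2 * (N / N0) := by field_simp
        _ < 1 := by linarith
    rw [he, hd]
    obtain ⟨G, g1, g2, g3, g4⟩ := trivial_graph
    refine ⟨G, g1, ?_, g3, g4⟩
    rw [g2]; push_cast; linarith


/-- There are constants `c1, c2, c3 > 0` and a family of DAGs
`{G_N}` with at most `c3·N` nodes and constant indegree that are
`(c1·N·log log N / log N, c2·N/(log N)^{1 + log log N})`-depth-robust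
(logarithms base 2). -/
theorem exists_intermediate_depth_robust_family :
    ∃ c1 c2 c3 : ℝ, 0 < c1 ∧ 0 < c2 ∧ 0 < c3 ∧
      ∃ (G : ℕ → Dig) (cind : ℕ), ∀ N : ℕ, 4 ≤ N →
        Acyclic (G N).Adj ∧
        ((Nat.card (G N).V : ℝ) ≤ c3 * N) ∧
        (∀ x : (G N).V, indeg (G N).Adj x ≤ cind) ∧
        DepthRobust (G N).Adj
          ⌊c1 * N * Real.logb 2 (Real.logb 2 N) / Real.logb 2 N⌋₊
          ⌊c2 * N / Real.logb 2 N ^ ((1 : ℝ) + Real.logb 2 (Real.logb 2 N))⌋₊ := by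
  obtain ⟨N0, hN0, h⟩ := final_aux
  have hN0' : (1 : ℝ) ≤ N0 := by exact_mod_cast hN0
  have : Nonempty Dig := ⟨trivial_graph.choose⟩
  choose! G hG using h
  exact ⟨1 / (10 ^ 7 * N0), 1 / (2 * N0), 48, by positivity, by positivity, by norm_num, G, 2, hG⟩
end

section
/- Let c > 0 and let H be a (c·n, n^{2/3})-depth-robust DAG on n nodes. Then there exist a constant τ (depending only on c) and a DAG G_n consisting of three disjoint copies H^1, H^2, H^3 of H together with additional edges directed from H^1 to H^2 and from H^2 to H^3, where each node of H^2 and of H^3 receives at most τ such additional incoming edges, such that: for every set S ⊆ V(G_n) with |S| ≤ c·n/2 there exist sets A ⊆ V(H^1) and B ⊆ V(H^3) with |A| ≥ 9c·n/40 and |B| ≥ 9c·n/40 such that for every pair of nodes u ∈ A and v ∈ B the graph G_n − S contains a directed path from u to v. -/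
lemma tlg_conn {V : Type*} (Adj : V → V → Prop) (S : Finset V) (u v : V) (hv : v ∉ S)
    (h : Relation.ReflTransGen (fun x y => Adj x y ∧ x ∉ S ∧ y ∉ S) u v) :
    ConnAvoiding Adj S u v := by
  induction h using Relation.ReflTransGen.head_induction_on with
  | refl => exact ⟨[v], ⟨by simp, List.IsChain.singleton v⟩, by simpa using hv, by simp, by simp⟩
  | @head a b hab _ ih =>
    obtain ⟨p, ⟨hp0, hp1⟩, hp2, hp3, hp4⟩ := ih
    refine ⟨a :: p, ⟨by simp, ?_⟩, ?_, by simp, ?_⟩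
    · cases p with
      | nil => simp at hp0
      | cons x l =>
        simp only [List.head?_cons, Option.some.injEq] at hp3
        subst hp3
        exact List.IsChain.cons_cons hab.1 hp1
    · intro x hx
      rcases List.mem_cons.1 hx with rfl | hx
      · exact hab.2.1
      · exact hp2 x hx
    · rw [List.getLast?_cons, hp4]; simp

lemma tlg_single {W : Type*} (HAdj : W → W → Prop) (hac : Acyclic HAdj) (S : Finset W)
    (d : ℕ) (p : List W) (hp : PathIn HAdj p) (hS : ∀ v ∈ p, v ∉ S) (hl : p.length = d + 1) :
    ∃ q : Fin (d + 1) → W, Function.Injective q ∧ (∀ m, q m ∉ S ∧ q m ∈ p) ∧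
      ∀ m m', m ≤ m' → Relation.ReflTransGen (fun x y => HAdj x y ∧ x ∉ S ∧ y ∉ S) (q m) (q m') := by
  have hch : p.IsChain HAdj := hp.2
  have hstep : ∀ i (h : i + 1 < p.length), HAdj p[i] p[i+1] := by
    intro i h
    exact List.isChain_iff_getElem.1 hch i h
  have hT : ∀ j i (hij : i < j) (hj : j < p.length),
      Relation.TransGen (fun x y => HAdj x y ∧ x ∉ S ∧ y ∉ S) p[i] p[j] := by
    intro j
    induction j with
    | zero => intro i h; omega
    | succ j ih =>
      intro i hij hj
      have hs : HAdj p[j] p[j+1] ∧ p[j] ∉ S ∧ p[j+1] ∉ S :=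
        ⟨hstep j hj, hS _ (List.getElem_mem _), hS _ (List.getElem_mem _)⟩
      rcases Nat.lt_succ_iff_lt_or_eq.1 hij with h | h
      · exact Relation.TransGen.tail (ih i h (by omega)) hs
      · subst h; exact Relation.TransGen.single hs
  have hne : ∀ i j (hij : i < j) (hj : j < p.length), p[i] ≠ p[j] := by
    intro i j hij hj he
    have h := hT j i hij hj
    have h2 : Relation.TransGen HAdj p[i] p[j] := Relation.TransGen.mono (fun _ _ h => h.1) _ _ h
    rw [he] at h2
    exact hac _ h2
  refine ⟨fun m => p[m.1]'(by omega), ?_, ?_, ?_⟩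
  · intro a b hab
    rcases lt_trichotomy a.1 b.1 with h | h | h
    · exact absurd hab (hne _ _ h (by omega))
    · exact Fin.ext h
    · exact absurd hab.symm (hne _ _ h (by omega))
  · intro m
    exact ⟨hS _ (List.getElem_mem _), List.getElem_mem _⟩
  · intro m m' h
    rcases lt_or_eq_of_le h with h | h
    · exact (hT _ _ h (by omega)).to_reflTransGen
    · subst h; exact Relation.ReflTransGen.refl

lemma tlg_family {W : Type*} [DecidableEq W] (HAdj : W → W → Prop) (hac : Acyclic HAdj)
    (e d : ℕ) (hdr : DepthRobust HAdj e d) (S : Finset W) (k : ℕ)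
    (hk : S.card + (k - 1) * (d + 1) ≤ e) :
    ∃ q : Fin k → Fin (d + 1) → W, (∀ i j a b, q i a = q j b → i = j ∧ a = b) ∧
      (∀ i m, q i m ∉ S) ∧
      ∀ i m m', m ≤ m' →
        Relation.ReflTransGen (fun x y => HAdj x y ∧ x ∉ S ∧ y ∉ S) (q i m) (q i m') := by
  induction k with
  | zero => exact ⟨fun i => i.elim0, fun i => i.elim0, fun i => i.elim0, fun i => i.elim0⟩
  | succ k ih =>
    obtain ⟨q, h1, h2, h3⟩ := ih (le_trans (by gcongr; omega) hk)
    let U : Finset W := S ∪ Finset.univ.image (fun x : Fin k × Fin (d+1) => q x.1 x.2)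
    have hU : U.card ≤ e := by
      refine le_trans (Finset.card_union_le _ _) (le_trans ?_ hk)
      gcongr
      refine le_trans Finset.card_image_le ?_
      simp
    obtain ⟨p, hp, hpU, hpl⟩ := hdr U hU
    obtain ⟨r, r1, r2, r3⟩ := tlg_single HAdj hac S d p hp
      (fun v hv hvS => hpU v hv (Finset.mem_union_left _ hvS)) hpl
    have hrq : ∀ i a b, q i a ≠ r b := by
      intro i a b he
      apply hpU (r b) (r2 b).2
      apply Finset.mem_union_right
      exact Finset.mem_image.2 ⟨(i, a), Finset.mem_univ _, he⟩
    refine ⟨Fin.cons r q, ?_, ?_, ?_⟩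
    · intro i j a b
      refine Fin.cases ?_ (fun i => ?_) i <;> refine Fin.cases ?_ (fun j => ?_) j
      · intro h; exact ⟨rfl, r1 h⟩
      · intro h; exact absurd h.symm (hrq _ _ _)
      · intro h; exact absurd h (hrq _ _ _)
      · intro h
        have := h1 i j a b h
        exact ⟨by rw [this.1], this.2⟩
    · intro i
      refine Fin.cases ?_ (fun i => ?_) i
      · exact fun m => (r2 m).1
      · exact h2 i
    · intro i
      refine Fin.cases ?_ (fun i => ?_) i
      · exact r3
      · exact h3 i

lemma tlg_random {W : Type*} [Fintype W] [DecidableEq W] [Nonempty W] {ι : Type*} [Fintype ι]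
    (F : ι → W → Finset W) (τ : ℕ) (β : ℝ) (hβ : 3 ≤ τ * β)
    (hι : Fintype.card ι ≤ 8 ^ Fintype.card W)
    (hF : ∀ i, β * (Fintype.card W : ℝ) ^ 2 ≤ ∑ y, ((F i y).card : ℝ)) :
    ∃ f : W → Fin τ → W, ∀ i, ∃ y t, f y t ∈ F i y := by
  classical
  set n := Fintype.card W with hn
  have hn0 : 0 < n := Fintype.card_pos
  have hnR : (0:ℝ) < n := by exact_mod_cast hn0
  by_contra! hcon
  let bad : ι → Finset (W → Fin τ → W) := fun i =>
    Fintype.piFinset (fun y => Fintype.piFinset (fun _ : Fin τ => (F i y)ᶜ))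
  have hcover : (Finset.univ : Finset (W → Fin τ → W)) ⊆ Finset.univ.biUnion bad := by
    intro f _
    obtain ⟨i, hi⟩ := hcon f
    refine Finset.mem_biUnion.2 ⟨i, Finset.mem_univ _, ?_⟩
    simp only [bad, Fintype.mem_piFinset, Finset.mem_compl]
    exact hi
  have hbad : ∀ i, ((bad i).card : ℝ) ≤ ((n : ℝ) ^ τ) ^ n * Real.exp (-(3 * n)) := by
    intro i
    have h1 : ((bad i).card : ℝ) = ∏ y, ((n : ℝ) - (F i y).card) ^ τ := by
      simp only [bad, Fintype.card_piFinset, Finset.prod_const, Finset.card_univ, Fintype.card_fin]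
      push_cast
      refine Finset.prod_congr rfl fun y _ => ?_
      rw [Finset.card_compl, Nat.cast_sub (Finset.card_le_univ _)]
    rw [h1]
    have h2 : ∀ y, ((n : ℝ) - (F i y).card) ^ τ ≤
        (n : ℝ) ^ τ * Real.exp (-(τ * ((F i y).card / n))) := by
      intro y
      have h3 : (0:ℝ) ≤ (n : ℝ) - (F i y).card := by
        have : (F i y).card ≤ n := Finset.card_le_univ _
        have : ((F i y).card : ℝ) ≤ n := by exact_mod_cast this
        linarith
      have h4 : (n : ℝ) - (F i y).card ≤ n * Real.exp (-((F i y).card / n)) := by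
        have := Real.one_sub_le_exp_neg ((F i y).card / n : ℝ)
        calc (n : ℝ) - (F i y).card = n * (1 - (F i y).card / n) := by field_simp
          _ ≤ _ := by gcongr
      calc ((n : ℝ) - (F i y).card) ^ τ ≤ (n * Real.exp (-((F i y).card / n))) ^ τ := by gcongr
        _ = _ := by rw [mul_pow, ← Real.exp_nat_mul]; ring_nf
    calc ∏ y, ((n : ℝ) - (F i y).card) ^ τ
        ≤ ∏ y, ((n : ℝ) ^ τ * Real.exp (-(τ * ((F i y).card / n)))) := by
          apply Finset.prod_le_prod
          · intro y _
            have : (F i y).card ≤ n := Finset.card_le_univ _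
            have : ((F i y).card : ℝ) ≤ n := by exact_mod_cast this
            exact pow_nonneg (by linarith) _
          · intro y _; exact h2 y
      _ = ((n : ℝ) ^ τ) ^ n * Real.exp (∑ y, (-(τ * ((F i y).card / n : ℝ)))) := by
          rw [Finset.prod_mul_distrib, Real.exp_sum]; simp [hn]
      _ ≤ _ := by
          gcongr
          rw [Finset.sum_neg_distrib, ← Finset.mul_sum, ← Finset.sum_div]
          have h5 : β * n ≤ (∑ y, ((F i y).card : ℝ)) / n := by
            rw [le_div_iff₀ hnR]; have := hF i; nlinarith
          have h6 : (τ : ℝ) * (β * n) ≤ τ * ((∑ y, ((F i y).card : ℝ)) / n) := by gcongr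
          nlinarith
  have htot : ((n : ℝ) ^ τ) ^ n ≤ (8 : ℝ) ^ n * (((n : ℝ) ^ τ) ^ n * Real.exp (-(3 * n))) := by
    have h1 := (Finset.card_le_card hcover).trans Finset.card_biUnion_le
    have h2 : ((Finset.univ : Finset (W → Fin τ → W)).card : ℝ) ≤ ∑ i, ((bad i).card : ℝ) := by
      exact_mod_cast h1
    have h3 : ((Finset.univ : Finset (W → Fin τ → W)).card : ℝ) = ((n : ℝ) ^ τ) ^ n := by
      simp [Finset.card_univ, hn]
    rw [h3] at h2
    refine h2.trans ((Finset.sum_le_sum fun i _ => hbad i).trans ?_)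
    rw [Finset.sum_const, nsmul_eq_mul, Finset.card_univ]
    gcongr
    exact_mod_cast hι
  have hpos : (0:ℝ) < ((n : ℝ) ^ τ) ^ n := by positivity
  have h8 : (8 : ℝ) ^ n * Real.exp (-(3 * n)) < 1 := by
    have : Real.exp (-(3 * n)) = (Real.exp (-3)) ^ n := by
      rw [← Real.exp_nat_mul]; ring_nf
    rw [this, ← mul_pow]
    refine pow_lt_one₀ (by positivity) ?_ hn0.ne'
    rw [Real.exp_neg, ← div_eq_mul_inv, div_lt_one (Real.exp_pos _)]
    have h2 := Real.exp_one_gt_d9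
    have : Real.exp 3 = (Real.exp 1) ^ 3 := by rw [← Real.exp_nat_mul]; norm_num
    rw [this]
    calc (8:ℝ) = 2 ^ 3 := by norm_num
      _ < _ := by gcongr; linarith
  nlinarith

lemma tlg_expander {W : Type*} [Fintype W] [DecidableEq W] [Nonempty W] (k h τ : ℕ) (c : ℝ)
    (hc : 0 < c) (P : Finset W → Prop) (X Y : Finset W → Fin k → Fin h → W)
    (hX : ∀ S, P S → ∀ i j a b, X S i a = X S j b → i = j ∧ a = b)
    (hY : ∀ S, P S → ∀ i j a b, Y S i a = Y S j b → i = j ∧ a = b)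
    (hk : k ^ 2 ≤ Fintype.card W) (hkh : c * (Fintype.card W : ℝ) / 4 ≤ k * h)
    (hτ : 3 ≤ τ * (c ^ 2 / 320)) :
    ∃ f : W → Fin τ → W, ∀ S T, P S → P T → ∀ N : Finset (Fin k × Fin k),
      (∀ x ∈ N, ∀ a b t, f (Y T x.2 b) t ≠ X S x.1 a) → 20 * N.card ≤ k ^ 2 := by
  classical
  set n := Fintype.card W with hn
  let F : Finset W × Finset W × Finset (Fin k × Fin k) → W → Finset W := fun s y =>
    Finset.univ.filter (fun x => ∃ z ∈ s.2.2, ∃ a b, Y s.2.1 z.2 b = y ∧ X s.1 z.1 a = x)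
  let ι := {s : Finset W × Finset W × Finset (Fin k × Fin k) //
    c ^ 2 / 320 * (n : ℝ) ^ 2 ≤ ∑ y, ((F s y).card : ℝ)}
  have hι : Fintype.card ι ≤ 8 ^ n := by
    refine (Fintype.card_subtype_le _).trans ?_
    simp only [Fintype.card_prod, Fintype.card_finset, Fintype.card_fin]
    calc 2 ^ n * (2 ^ n * 2 ^ (k * k)) ≤ 2 ^ n * (2 ^ n * 2 ^ n) := by
          gcongr
          · norm_num
          · nlinarith
      _ = 8 ^ n := by rw [← mul_pow, ← mul_pow]; norm_num
  obtain ⟨f, hf⟩ := tlg_random (fun i : ι => F i.1) τ (c ^ 2 / 320) hτ hι (fun i => i.2)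
  refine ⟨f, fun S T hS hT N hN => ?_⟩
  by_contra! hlt
  have hsum : N.card * (h * h) ≤ ∑ y, (F (S, T, N) y).card := by
    have h1 : ∑ y, (F (S, T, N) y).card =
        (Finset.univ.sigma (fun y => F (S, T, N) y)).card := by
      rw [Finset.card_sigma]
    have h2 : N.card * (h * h) =
        (N ×ˢ (Finset.univ : Finset (Fin h × Fin h))).card := by
      simp
    rw [h1, h2]
    refine Finset.card_le_card_of_injOn
      (fun z => (⟨Y T z.1.2 z.2.2, X S z.1.1 z.2.1⟩ : Σ _ : W, W)) ?_ ?_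
    · intro z hz
      have hz' : z.1 ∈ N := by simpa using hz
      simp only [Finset.coe_sigma, Set.mem_sigma_iff, Finset.coe_univ, Set.mem_univ, true_and,
        Finset.mem_coe, F, Finset.mem_filter, Finset.mem_univ]
      exact ⟨z.1, hz', z.2.1, z.2.2, rfl, rfl⟩
    · rintro ⟨⟨i, j⟩, a, b⟩ _ ⟨⟨i', j'⟩, a', b'⟩ _ he
      simp only [Sigma.mk.injEq, heq_eq_eq] at he
      obtain ⟨rfl, rfl⟩ := hY T hT _ _ _ _ he.1
      obtain ⟨rfl, rfl⟩ := hX S hS _ _ _ _ he.2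
      rfl
  have hmem : c ^ 2 / 320 * (n : ℝ) ^ 2 ≤ ∑ y, ((F (S, T, N) y).card : ℝ) := by
    have h1 : (N.card : ℝ) * (h * h) ≤ ∑ y, ((F (S, T, N) y).card : ℝ) := by exact_mod_cast hsum
    refine le_trans ?_ h1
    have h2 : (k : ℝ) ^ 2 ≤ 20 * N.card := by exact_mod_cast hlt.le
    have h3 : (c * n / 4) ^ 2 ≤ (k * h : ℝ) ^ 2 := by gcongr
    have h4 : (k : ℝ) ^ 2 * (h * h) ≤ 20 * N.card * (h * h) := by gcongr
    nlinarith
  obtain ⟨y, t, hyt⟩ := hf ⟨(S, T, N), hmem⟩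
  simp only [F, Finset.mem_filter, Finset.mem_univ, true_and] at hyt
  obtain ⟨z, hz, a, b, hy, hx⟩ := hyt
  exact hN z hz a b t (by rw [hy, hx])

lemma tlg_few {k : ℕ} (R : Fin k → Fin k → Prop) [DecidableRel R]
    (hR : 20 * (Finset.univ.filter (fun x : Fin k × Fin k => R x.1 x.2)).card ≤ k ^ 2)
    (hk : 0 < k) :
    2 * (Finset.univ.filter (fun j : Fin k =>
      k < 10 * (Finset.univ.filter (fun i => R i j)).card)).card < k := by
  set J := Finset.univ.filter (fun j : Fin k =>
      k < 10 * (Finset.univ.filter (fun i => R i j)).card) with hJ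
  have h1 : (Finset.univ.filter (fun x : Fin k × Fin k => R x.1 x.2)).card =
      ∑ j, (Finset.univ.filter (fun i => R i j)).card := by
    simp only [Finset.card_filter]
    rw [Fintype.sum_prod_type, Finset.sum_comm]
  have h2 : J.card * (k + 1) ≤ ∑ j, 10 * (Finset.univ.filter (fun i => R i j)).card := by
    calc J.card * (k + 1) = ∑ j ∈ J, (k + 1) := by simp
      _ ≤ ∑ j ∈ J, 10 * (Finset.univ.filter (fun i => R i j)).card := by
        apply Finset.sum_le_sum
        intro j hj
        exact (Finset.mem_filter.1 hj).2
      _ ≤ _ := Finset.sum_le_sum_of_subset (Finset.subset_univ _)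
  rw [← Finset.mul_sum, ← h1] at h2
  by_contra! hcon
  nlinarith

/-- Let `c > 0` and let `H` be a `(c·n, n^{2/3})`-depth-robust
DAG on `n` nodes.  Then there are a constant `τ` (depending only on `c`) and a
DAG `G_n` made of three disjoint copies `H^1, H^2, H^3` of `H` (the layers `0`,
`1`, `2`) together with extra edges directed from `H^1` to `H^2` and from `H^2`
to `H^3`, at most `τ` extra incoming edges per node of `H^2` and `H^3`, such
that for every `S` with `|S| ≤ c·n/2` there are sets `A ⊆ V(H^1)` and
`B ⊆ V(H^3)` of size at least `9c·n/40` with every node of `A` joined to every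
node of `B` by a directed path in `G_n − S`. -/
theorem three_layer_grates (c : ℝ) (hc : 0 < c) :
    ∃ τ : ℕ, ∀ (W : Type) [Fintype W] [DecidableEq W],
      ∀ (n : ℕ) (HAdj : W → W → Prop), Acyclic HAdj → Nat.card W = n →
      DepthRobust HAdj ⌊c * n⌋₊ ⌊(n : ℝ) ^ ((2 : ℝ) / 3)⌋₊ →
      ∃ Extra : W × Fin 3 → W × Fin 3 → Prop,
        (∀ x y, Extra x y → (x.2 = 0 ∧ y.2 = 1) ∨ (x.2 = 1 ∧ y.2 = 2)) ∧
        (∀ y : W × Fin 3, Nat.card {x // Extra x y} ≤ τ) ∧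
        ∀ S : Finset (W × Fin 3), (S.card : ℝ) ≤ c * n / 2 →
          ∃ A B : Finset (W × Fin 3),
            (∀ a ∈ A, a.2 = 0) ∧ (∀ b ∈ B, b.2 = 2) ∧
            9 * c * n / 40 ≤ (A.card : ℝ) ∧ 9 * c * n / 40 ≤ (B.card : ℝ) ∧
            ∀ u ∈ A, ∀ v ∈ B,
              ConnAvoiding (fun x y => (x.2 = y.2 ∧ HAdj x.1 y.1) ∨ Extra x y)
                S u v := by
  classical
  refine ⟨⌈960 / c ^ 2⌉₊, ?_⟩
  intro W _ _ n HAdj hac hn hdr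
  set τ := ⌈960 / c ^ 2⌉₊ with hτdef
  have hτ : (3:ℝ) ≤ τ * (c ^ 2 / 320) := by
    have h1 : 960 / c ^ 2 ≤ (τ : ℝ) := Nat.le_ceil _
    have h2 : 960 / c ^ 2 * (c ^ 2 / 320) = 3 := by field_simp; norm_num
    rw [← h2]; gcongr
  set d := ⌊(n : ℝ) ^ ((2 : ℝ) / 3)⌋₊ with hd
  rw [Nat.card_eq_fintype_card] at hn
  have hne : Nonempty W := by
    obtain ⟨p, hp, -, -⟩ := hdr ∅ (by simp)
    exact ⟨p.head hp.1⟩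
  have hn1 : 1 ≤ n := by rw [← hn]; exact Fintype.card_pos
  have hn1R : (1:ℝ) ≤ n := by exact_mod_cast hn1
  have hdn : n ≤ (d + 1) ^ 2 := by
    have h1 : (n : ℝ) ^ ((2 : ℝ) / 3) ≤ d + 1 := (Nat.lt_floor_add_one _).le
    have h2 : (n : ℝ) ^ ((1 : ℝ) / 2) ≤ (n : ℝ) ^ ((2 : ℝ) / 3) :=
      Real.rpow_le_rpow_of_exponent_le hn1R (by norm_num)
    have h3 : (n : ℝ) = ((n : ℝ) ^ ((1 : ℝ) / 2)) ^ 2 := by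
      rw [← Real.rpow_natCast, ← Real.rpow_mul (by positivity)]; norm_num
    have h4 : (n : ℝ) ≤ ((d : ℝ) + 1) ^ 2 := by
      rw [h3]
      have := h2.trans h1
      gcongr
    exact_mod_cast h4
  set k := ⌊c * n / (2 * (d + 1))⌋₊ + 1 with hk
  have hk0 : 0 < k := by omega
  have hdpos : (0:ℝ) < 2 * ((d:ℝ) + 1) := by positivity
  have hkle : ((k - 1 : ℕ) : ℝ) * (d + 1) ≤ c * n / 2 := by
    have h1 : ((k - 1 : ℕ) : ℝ) ≤ c * n / (2 * (d + 1)) := by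
      rw [hk, Nat.add_sub_cancel]; exact Nat.floor_le (by positivity)
    rw [le_div_iff₀ hdpos] at h1
    linarith
  have hkge : c * n / 2 ≤ k * (d + 1) := by
    have h1 : c * n / (2 * (d + 1)) < k := by
      rw [hk]; push_cast; exact Nat.lt_floor_add_one _
    rw [div_lt_iff₀ hdpos] at h1
    linarith
  have hfam : ∀ S : Finset W, ∃ q : Fin k → Fin (d + 1) → W, (S.card : ℝ) ≤ c * n / 2 →
      (∀ i j a b, q i a = q j b → i = j ∧ a = b) ∧
      (∀ i m, q i m ∉ S) ∧
      ∀ i m m', m ≤ m' →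
        Relation.ReflTransGen (fun x y => HAdj x y ∧ x ∉ S ∧ y ∉ S) (q i m) (q i m') := by
    intro S
    by_cases hS : (S.card : ℝ) ≤ c * n / 2
    · obtain ⟨q, hq⟩ := tlg_family HAdj hac _ d hdr S k (by
        apply Nat.le_floor
        push_cast
        linarith)
      exact ⟨q, fun _ => hq⟩
    · exact ⟨fun _ _ => Classical.arbitrary W, fun h => absurd h hS⟩
  choose q hq using hfam
  have hkd : k * (d + 1) ≤ n := by
    have h0 := (hq ∅ (by simp; positivity)).1
    have hinj : Function.Injective (fun x : Fin k × Fin (d+1) => q ∅ x.1 x.2) := by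
      rintro ⟨i, a⟩ ⟨j, b⟩ he
      obtain ⟨rfl, rfl⟩ := h0 _ _ _ _ he
      rfl
    have := Fintype.card_le_of_injective _ hinj
    simpa [hn] using this
  have hk2 : k ^ 2 ≤ n := by
    have h1 : k ^ 2 * n ≤ n * n := by
      calc k ^ 2 * n ≤ k ^ 2 * (d + 1) ^ 2 := by gcongr
        _ = (k * (d + 1)) * (k * (d + 1)) := by ring
        _ ≤ _ := by gcongr
    exact Nat.le_of_mul_le_mul_right h1 hn1
  set h := (d + 2) / 2 with hh
  have hhd : h ≤ d + 1 := by omega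
  have hhd2 : d + 1 ≤ 2 * h := by omega
  have hhR : (d : ℝ) + 1 ≤ 2 * h := by exact_mod_cast hhd2
  let lo : Fin h → Fin (d + 1) := Fin.castLE hhd
  let hi : Fin h → Fin (d + 1) := fun a => Fin.rev (Fin.castLE hhd a)
  have hlo : Function.Injective lo := Fin.castLE_injective hhd
  have hhi : Function.Injective hi := Fin.rev_injective.comp (Fin.castLE_injective hhd)
  have hlohi : ∀ a b, lo a ≤ hi b := by
    intro a b
    have := a.2
    have := b.2
    simp only [lo, hi, Fin.le_def, Fin.val_rev, Fin.val_castLE]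
    omega
  have hkh : c * n / 4 ≤ (k : ℝ) * h := by
    have : (k : ℝ) * (d + 1) ≤ k * (2 * h) := by gcongr
    linarith
  obtain ⟨f, hf⟩ := tlg_expander k h τ c hc (fun S : Finset W => (S.card : ℝ) ≤ c * n / 2)
    (fun S i a => q S i (hi a)) (fun S i a => q S i (lo a))
    (fun S hS i j a b he => by
      have := (hq S hS).1 _ _ _ _ he
      exact ⟨this.1, hhi this.2⟩)
    (fun S hS i j a b he => by
      have := (hq S hS).1 _ _ _ _ he
      exact ⟨this.1, hlo this.2⟩)
    (by rw [hn]; exact hk2) (by rw [hn]; exact hkh) hτ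
  refine ⟨fun x y => ((x.2 = 0 ∧ y.2 = 1) ∨ (x.2 = 1 ∧ y.2 = 2)) ∧ ∃ t, f y.1 t = x.1,
    fun x y hxy => hxy.1, ?_, ?_⟩
  · intro y
    let g : Fin τ → W × Fin 3 := fun t => (f y.1 t, if y.2 = 1 then 0 else 1)
    have hsub : {x : W × Fin 3 | ((x.2 = 0 ∧ y.2 = 1) ∨ (x.2 = 1 ∧ y.2 = 2)) ∧
        ∃ t, f y.1 t = x.1} ⊆ ((Finset.univ.image g : Finset (W × Fin 3)) : Set (W × Fin 3)) := by
      rintro ⟨x, l⟩ ⟨hl, t, ht⟩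
      simp only [Finset.coe_image, Finset.coe_univ, Set.image_univ, Set.mem_range]
      refine ⟨t, ?_⟩
      simp only at hl ht
      rcases hl with ⟨h1, h2⟩ | ⟨h1, h2⟩ <;> simp [g, h1, h2, ht]
    have h1 := Set.ncard_le_ncard hsub (Finset.finite_toSet _)
    rw [Set.ncard_coe_finset] at h1
    refine le_trans h1 (Finset.card_image_le.trans ?_)
    simp
  · intro S hS
    let L : Fin 3 → Finset W := fun l => Finset.univ.filter (fun w => (w, l) ∈ S)
    have hLmem : ∀ l w, w ∈ L l ↔ (w, l) ∈ S := by intro l w; simp [L]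
    have hL : ∀ l, ((L l).card : ℝ) ≤ c * n / 2 := by
      intro l
      refine le_trans ?_ hS
      have : (L l).card ≤ S.card := by
        refine Finset.card_le_card_of_injOn (fun w => (w, l)) ?_ ?_
        · intro w hw; exact (hLmem l w).1 hw
        · intro a _ b _ hab; exact (Prod.ext_iff.1 hab).1
      exact_mod_cast this
    let R : Fin 3 → Fin 3 → Fin k → Fin k → Prop := fun l l' i j =>
      ∃ a b t, f (q (L l') j (lo b)) t = q (L l) i (hi a)
    have hN : ∀ l l', 20 * (Finset.univ.filter
        (fun x : Fin k × Fin k => ¬ R l l' x.1 x.2)).card ≤ k ^ 2 := by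
      intro l l'
      refine hf (L l) (L l') (hL l) (hL l') _ ?_
      intro x hx a b t he
      exact (Finset.mem_filter.1 hx).2 ⟨a, b, t, he⟩
    have hJ1 := tlg_few (fun i j => ¬ R 0 1 i j) (hN 0 1) hk0
    have hJ2 := tlg_few (fun i j => ¬ R 1 2 j i) (by
      refine le_trans (le_of_eq ?_) (hN 1 2)
      congr 1
      refine Finset.card_bij (fun x _ => (x.2, x.1)) ?_ ?_ ?_
      · intro x hx; simpa using hx
      · rintro ⟨a, b⟩ _ ⟨a', b'⟩ _ he
        simp only [Prod.mk.injEq] at he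
        simp [he.1, he.2]
      · rintro ⟨a, b⟩ hx
        exact ⟨(b, a), by simpa using hx, rfl⟩) hk0
    set J1 := Finset.univ.filter (fun j : Fin k =>
      k < 10 * (Finset.univ.filter (fun i => ¬ R 0 1 i j)).card) with hJ1d
    set J2 := Finset.univ.filter (fun j : Fin k =>
      k < 10 * (Finset.univ.filter (fun i => ¬ R 1 2 j i)).card) with hJ2d
    obtain ⟨j, hj⟩ : ∃ j, j ∉ J1 ∪ J2 := by
      by_contra! hall
      have h1 : (J1 ∪ J2).card = k := by
        rw [Finset.eq_univ_iff_forall.2 hall]; simp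
      have := Finset.card_union_le J1 J2
      omega
    rw [Finset.mem_union, not_or] at hj
    have hj1 : 10 * (Finset.univ.filter (fun i => ¬ R 0 1 i j)).card ≤ k := by
      by_contra! hlt
      exact hj.1 (Finset.mem_filter.2 ⟨Finset.mem_univ _, hlt⟩)
    have hj2 : 10 * (Finset.univ.filter (fun i => ¬ R 1 2 j i)).card ≤ k := by
      by_contra! hlt
      exact hj.2 (Finset.mem_filter.2 ⟨Finset.mem_univ _, hlt⟩)
    have hcount : ∀ (l : Fin 3) (Q : Fin k → Prop) (e : Fin h → Fin (d + 1)),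
        Function.Injective e → 10 * (Finset.univ.filter (fun i => ¬ Q i)).card ≤ k →
        9 * c * n / 40 ≤ ((((Finset.univ.filter Q) ×ˢ (Finset.univ : Finset (Fin h))).image
          (fun x => (q (L l) x.1 (e x.2), l))).card : ℝ) := by
      intro l Q e he hQ
      rw [Finset.card_image_of_injective]
      · have h1 := Finset.card_filter_add_card_filter_not (s := (Finset.univ : Finset (Fin k))) Q
        rw [Finset.card_univ, Fintype.card_fin] at h1
        have h2 : 9 * k ≤ 10 * (Finset.univ.filter Q).card := by omega
        have h3 : 9 * (k : ℝ) ≤ 10 * ((Finset.univ.filter Q).card : ℝ) := by exact_mod_cast h2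
        rw [Finset.card_product, Finset.card_univ, Fintype.card_fin]
        push_cast
        have h4 : 9 * (k : ℝ) * h ≤ 10 * ((Finset.univ.filter Q).card : ℝ) * h := by gcongr
        linarith
      · rintro ⟨i, a⟩ ⟨i', a'⟩ hx
        have := (hq (L l) (hL l)).1 _ _ _ _ (Prod.ext_iff.1 hx).1
        exact Prod.ext this.1 (he this.2)
    refine ⟨_, _, ?_, ?_, hcount 0 (fun i => R 0 1 i j) lo hlo (by convert hj1),
      hcount 2 (fun i => R 1 2 j i) hi hhi (by convert hj2), ?_⟩
    · intro a ha
      obtain ⟨x, _, rfl⟩ := Finset.mem_image.1 ha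
      rfl
    · intro a ha
      obtain ⟨x, _, rfl⟩ := Finset.mem_image.1 ha
      rfl
    · intro u hu v hv
      obtain ⟨⟨i, s⟩, hi1, rfl⟩ := Finset.mem_image.1 hu
      obtain ⟨⟨i', s'⟩, hi2, rfl⟩ := Finset.mem_image.1 hv
      have hR1 : R 0 1 i j := by simpa using hi1
      have hR2 : R 1 2 j i' := by simpa using hi2
      obtain ⟨a, b, t, h1⟩ := hR1
      obtain ⟨a', b', t', h2⟩ := hR2
      have hav : ∀ l i m, (q (L l) i m, l) ∉ S := by
        intro l i m hm
        exact (hq (L l) (hL l)).2.1 i m ((hLmem l _).2 hm)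
      apply tlg_conn
      · exact hav _ _ _
      have hwalk : ∀ (l : Fin 3) i a b, Relation.ReflTransGen (fun x y : W × Fin 3 =>
          ((x.2 = y.2 ∧ HAdj x.1 y.1) ∨ (((x.2 = 0 ∧ y.2 = 1) ∨ (x.2 = 1 ∧ y.2 = 2)) ∧
            ∃ t, f y.1 t = x.1)) ∧ x ∉ S ∧ y ∉ S)
          (q (L l) i (lo a), l) (q (L l) i (hi b), l) := by
        intro l i a b
        refine Relation.ReflTransGen.lift (fun w => (w, l)) ?_ _ _
          ((hq (L l) (hL l)).2.2 i _ _ (hlohi a b))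
        intro x y hxy
        exact ⟨Or.inl ⟨rfl, hxy.1⟩, fun hm => hxy.2.1 ((hLmem l _).2 hm),
          fun hm => hxy.2.2 ((hLmem l _).2 hm)⟩
      refine (hwalk 0 i s a).trans (Relation.ReflTransGen.head ?_
        ((hwalk 1 j b a').trans (Relation.ReflTransGen.head ?_ (hwalk 2 i' b' s'))))
      · exact ⟨Or.inr ⟨Or.inl ⟨rfl, rfl⟩, t, h1⟩, hav _ _ _, hav _ _ _⟩
      · exact ⟨Or.inr ⟨Or.inr ⟨rfl, rfl⟩, t', h2⟩, hav _ _ _, hav _ _ _⟩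
end
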